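/- arXiv:1601.00717 — 2 statements merged into one kernel-verified Lean document; each statement's English description precedes it below -/
import Mathlib

section
/- The probability measure π on Δ with density ρ(x^1,…,x^m,y) = Z^{−1} y^{−1/2} (with respect to Lebesgue measure on U, Z = ∫_U y^{−1/2} dx being a finite normalizing constant) is an invariant measure for the energy-exchange process: πP^t = π for every t ≥ 0. -/
open MeasureTheory Set Filter

noncomputable section

/-- The open set `U ⊂ ℝ^m` with which the open simplex `Δ` is identified
(via `y = Ē - ∑ i, x i`). -/
def simU (m : ℕ) (E : ℝ) : Set (Fin m → ℝ) := {x | (∀ i, 0 < x i) ∧ ∑ i, x i < E}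

/-- The state space `Δ`. -/
abbrev Delta (m : ℕ) (E : ℝ) : Type := ↥(simU m E)

/-- The tank energy `y = Ē - ∑ i, x i`. -/
def tank (m : ℕ) (E : ℝ) (x : Delta m E) : ℝ := E - ∑ i, x.1 i

/-- The energy exchange map on the ambient space: particle `i` gets energy
`y + (1-u²) x^i`, and the new tank energy is `u² x^i`. -/
def T0 (m : ℕ) (E : ℝ) (i : Fin m) (u : ℝ) (x : Fin m → ℝ) : Fin m → ℝ :=
  Function.update x i ((E - ∑ j, x j) + (1 - u ^ 2) * x i)

lemma T0_mem {m : ℕ} {E : ℝ} {i : Fin m} {u : ℝ} {x : Fin m → ℝ}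
    (hx : x ∈ simU m E) (hu : u ∈ Ioo (0:ℝ) 1) : T0 m E i u x ∈ simU m E := by
  obtain ⟨hpos, hsum⟩ := hx
  obtain ⟨hu0, hu1⟩ := hu
  have hy : 0 < E - ∑ j, x j := sub_pos.mpr hsum
  have hu2 : 0 < 1 - u ^ 2 := by nlinarith
  have hxi := hpos i
  constructor
  · intro j
    rcases eq_or_ne j i with rfl | hj
    · simp only [T0, Function.update_self]
      nlinarith
    · simpa [T0, Function.update_of_ne hj] using hpos j
  · have h1 : ∑ j, T0 m E i u x j
        = ((E - ∑ j, x j) + (1 - u ^ 2) * x i) + ∑ j ∈ Finset.univ \ {i}, x j := by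
      simp only [T0]
      rw [Finset.sum_update_of_mem (Finset.mem_univ i)]
    have h2 : ∑ j ∈ Finset.univ \ {i}, x j = (∑ j, x j) - x i := by
      rw [← Finset.erase_eq]
      exact Finset.sum_erase_eq_sub (Finset.mem_univ i)
    rw [h1, h2]
    nlinarith [mul_pos (mul_pos hu0 hu0) hxi]

/-- The energy exchange map `T_{i,u} : Δ → Δ` (defined to be the identity for
`u ∉ (0,1)`, which is a probability-zero event). -/
def Texch (m : ℕ) (E : ℝ) (i : Fin m) (u : ℝ) (x : Delta m E) : Delta m E :=
  if hu : u ∈ Ioo (0:ℝ) 1 then ⟨T0 m E i u x.1, T0_mem x.2 hu⟩ else x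

/-- The uniform distribution on `(0,1)`. -/
def unif01 : Measure ℝ := volume.restrict (Ioo (0:ℝ) 1)

/-- The uniformization constant `Λ = √(m Ē)`, an upper bound for the total jump rate. -/
def Lam (m : ℕ) (E : ℝ) : ℝ := Real.sqrt (m * E)

/-- The total jump rate `∑ i, √(x^i)`. -/
def jumpRate (m : ℕ) (E : ℝ) (x : Delta m E) : ℝ := ∑ i, Real.sqrt (x.1 i)

/-- One step of the uniformized embedded chain: with probability `1 - r(x)/Λ` stay put,
and with probability `√(x^i)/Λ` particle `i` exchanges energy with the tank, with
`u` drawn uniformly from `(0,1)`. -/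
def ustep (m : ℕ) (E : ℝ) (x : Delta m E) : Measure (Delta m E) :=
  ENNReal.ofReal (1 - jumpRate m E x / Lam m E) • Measure.dirac x
  + (ENNReal.ofReal (Lam m E))⁻¹ •
      Measure.sum (fun i : Fin m =>
        ENNReal.ofReal (Real.sqrt (x.1 i)) • Measure.map (fun u => Texch m E i u x) unif01)

/-- `n`-fold iterate of the uniformized chain. -/
def ustepIter (m : ℕ) (E : ℝ) : ℕ → Delta m E → Measure (Delta m E)
  | 0 => fun x => Measure.dirac x
  | (n+1) => fun x => (ustep m E x).bind (ustepIter m E n)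

/-- The transition probabilities `P^t(x, ·)` of the energy-exchange jump process,
constructed by uniformization: `P^t = ∑ₙ e^{-Λt} (Λt)ⁿ/n! Kⁿ`. -/
def Pt (m : ℕ) (E : ℝ) (t : ℝ) (x : Delta m E) : Measure (Delta m E) :=
  Measure.sum (fun n : ℕ =>
    ENNReal.ofReal (Real.exp (-(Lam m E) * t) * ((Lam m E) * t) ^ n / n.factorial) •
      ustepIter m E n x)

/-- Lebesgue measure on `Δ ≅ U`. -/
def lebU (m : ℕ) (E : ℝ) : Measure (Delta m E) := Measure.comap Subtype.val volume

/-- The (unnormalized) measure with density `y^{-1/2}` w.r.t. Lebesgue measure on `U`. -/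
def piPre (m : ℕ) (E : ℝ) : Measure (Delta m E) :=
  (lebU m E).withDensity (fun x => ENNReal.ofReal ((tank m E x) ^ (-(1/2) : ℝ)))

/-- The invariant probability measure `π`, with density `Z⁻¹ y^{-1/2}`. -/
def piMeasure (m : ℕ) (E : ℝ) : Measure (Delta m E) :=
  (piPre m E Set.univ)⁻¹ • piPre m E

/-- Total variation distance between two (finite) measures:
`sup_A |μ(A) - ν(A)|`. -/
def tvDist {X : Type*} [MeasurableSpace X] (μ ν : Measure X) : ℝ :=
  ⨆ A : {A : Set X // MeasurableSet A}, |(μ A.1).toReal - (ν A.1).toReal|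

end

lemma aux_L0 (a s : ℝ) (h : a ≤ s) :
    ∫⁻ t in Ioo a s, ENNReal.ofReal ((s - t) ^ (-(1/2) : ℝ)) = ENNReal.ofReal (2 * √(s - a)) := by
  have hint : IntervalIntegrable (fun t : ℝ => (s - t) ^ (-(1/2) : ℝ)) volume a s := by
    have := (intervalIntegral.intervalIntegrable_rpow' (a := s - a) (b := s - s)
      (r := (-(1/2) : ℝ)) (by norm_num)).comp_sub_left s
    simpa using this
  have hI : ∫ t in a..s, (s - t) ^ (-(1/2) : ℝ) = 2 * √(s - a) := by
    rw [intervalIntegral.integral_comp_sub_left (fun t => t ^ (-(1/2) : ℝ)) s,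
      integral_rpow (Or.inl (by norm_num)), Real.sqrt_eq_rpow]
    norm_num
    ring
  have hon : IntegrableOn (fun t : ℝ => (s - t) ^ (-(1/2) : ℝ)) (Ioc a s) volume :=
    (intervalIntegrable_iff_integrableOn_Ioc_of_le h).1 hint
  rw [← hI, intervalIntegral.integral_of_le h, restrict_Ioo_eq_restrict_Ioc,
    ofReal_integral_eq_lintegral_ofReal hon]
  filter_upwards [ae_restrict_mem measurableSet_Ioc] with t ht
  exact Real.rpow_nonneg (by linarith [ht.2]) _

lemma aux_L1 (s t : ℝ) (ht : 0 < t) (h : ℝ → ENNReal) :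
    ENNReal.ofReal (√t) * ∫⁻ u in Ioo (0:ℝ) 1, h (s - u ^ 2 * t) =
      ∫⁻ v in Ioo (s - t) s, h v * ENNReal.ofReal ((s - v) ^ (-(1/2) : ℝ) / 2) := by
  have himg : (fun u : ℝ => s - u ^ 2 * t) '' Ioo (0:ℝ) 1 = Ioo (s - t) s := by
    ext v
    simp only [mem_image, mem_Ioo]
    constructor
    · rintro ⟨u, ⟨h0, h1⟩, rfl⟩
      have : u ^ 2 < 1 := by nlinarith
      constructor <;> nlinarith [mul_pos (pow_pos h0 2) ht]
    · rintro ⟨h0, h1⟩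
      have h2 : 0 < (s - v) / t := div_pos (by linarith) ht
      refine ⟨√((s - v) / t), ⟨Real.sqrt_pos.2 h2, ?_⟩, ?_⟩
      · rw [Real.sqrt_lt' one_pos, div_lt_iff₀ ht]; linarith
      · rw [Real.sq_sqrt h2.le]; field_simp; ring
  have hinj : InjOn (fun u : ℝ => s - u ^ 2 * t) (Ioo (0:ℝ) 1) := by
    intro a ha b hb hab
    simp only at hab
    have : a ^ 2 = b ^ 2 := mul_right_cancel₀ ht.ne' (by linarith)
    exact (pow_left_inj₀ ha.1.le hb.1.le two_ne_zero).1 this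
  rw [← himg, lintegral_image_eq_lintegral_abs_deriv_mul (f' := fun u => -(2 * u * t))
    measurableSet_Ioo ?_ hinj, ← lintegral_const_mul' _ _ ENNReal.ofReal_ne_top]
  · refine setLIntegral_congr_fun measurableSet_Ioo ?_
    intro u hu
    have hu0 := hu.1
    simp only
    rw [mul_comm (h _), ← mul_assoc, ← ENNReal.ofReal_mul (abs_nonneg _)]
    congr 2
    have e1 : s - (s - u ^ 2 * t) = u ^ 2 * t := by ring
    rw [e1, abs_neg, abs_of_pos (by positivity), Real.rpow_neg (by positivity),
      ← Real.sqrt_eq_rpow, Real.sqrt_mul (by positivity), Real.sqrt_sq hu0.le]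
    have := Real.sqrt_pos.2 ht
    field_simp
    rw [Real.sq_sqrt ht.le]
  · intro u hu
    have := (((hasDerivAt_id u).pow 2).mul_const t).const_sub s
    refine (this.congr_deriv ?_).hasDerivWithinAt
    simp

lemma aux_L2 (s : ℝ) (h : ℝ → ENNReal) (hh : Measurable h) :
    ∫⁻ t in Ioo 0 s, ENNReal.ofReal ((s - t) ^ (-(1/2) : ℝ)) *
        (ENNReal.ofReal (√t) * ∫⁻ u in Ioo (0:ℝ) 1, h (s - u ^ 2 * t)) =
      ∫⁻ t in Ioo 0 s, ENNReal.ofReal ((s - t) ^ (-(1/2) : ℝ)) *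
        (ENNReal.ofReal (√t) * h t) := by
  have e1 : ∀ t ∈ Ioo 0 s, ENNReal.ofReal ((s - t) ^ (-(1/2) : ℝ)) *
        (ENNReal.ofReal (√t) * ∫⁻ u in Ioo (0:ℝ) 1, h (s - u ^ 2 * t)) =
      ∫⁻ v in Ioo 0 s, (Ioi (s - t)).indicator (fun v => ENNReal.ofReal ((s - t) ^ (-(1/2) : ℝ)) *
        (h v * ENNReal.ofReal ((s - v) ^ (-(1/2) : ℝ) / 2))) v := by
    intro t ht
    rw [aux_L1 s t ht.1, lintegral_indicator measurableSet_Ioi,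
      Measure.restrict_restrict measurableSet_Ioi,
      ← lintegral_const_mul' _ _ ENNReal.ofReal_ne_top]
    congr 2
    ext v
    simp only [mem_Ioo, mem_inter_iff, mem_Ioi]
    constructor
    · rintro ⟨h1, h2⟩; exact ⟨h1, by linarith [ht.2], h2⟩
    · rintro ⟨h1, h2, h3⟩; exact ⟨h1, h3⟩
  rw [setLIntegral_congr_fun measurableSet_Ioo e1, lintegral_lintegral_swap]
  · refine setLIntegral_congr_fun measurableSet_Ioo ?_
    intro v hv
    have e2 : ∀ t, (Ioi (s - t)).indicator (fun v => ENNReal.ofReal ((s - t) ^ (-(1/2) : ℝ)) *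
        (h v * ENNReal.ofReal ((s - v) ^ (-(1/2) : ℝ) / 2))) v =
        (Ioi (s - v)).indicator (fun t => ENNReal.ofReal ((s - t) ^ (-(1/2) : ℝ)) *
        (h v * ENNReal.ofReal ((s - v) ^ (-(1/2) : ℝ) / 2))) t := by
      intro t
      simp only [indicator, mem_Ioi]
      congr 1
      exact propext ⟨fun _ => by linarith, fun _ => by linarith⟩
    simp only [e2]
    have hset : Ioi (s - v) ∩ Ioo 0 s = Ioo (s - v) s := by
      ext t
      simp only [mem_Ioo, mem_inter_iff, mem_Ioi]
      constructor
      · rintro ⟨h1, h2, h3⟩; exact ⟨h1, h3⟩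
      · rintro ⟨h1, h2⟩; exact ⟨h1, by linarith [hv.2], h2⟩
    rw [lintegral_indicator measurableSet_Ioi, Measure.restrict_restrict measurableSet_Ioi, hset,
      lintegral_mul_const _ (by fun_prop), aux_L0 _ _ (by linarith [hv.1])]
    have e3 : s - (s - v) = v := by ring
    rw [e3]
    have hp : 0 ≤ (s - v) ^ (-(1/2) : ℝ) := Real.rpow_nonneg (by linarith [hv.2]) _
    rw [mul_left_comm, ← ENNReal.ofReal_mul (by positivity), mul_comm (ENNReal.ofReal √v),
      mul_left_comm, ← ENNReal.ofReal_mul hp]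
    congr 2
    ring
  · apply Measurable.aemeasurable
    have : Function.uncurry (fun t v => (Ioi (s - t)).indicator
        (fun v => ENNReal.ofReal ((s - t) ^ (-(1/2) : ℝ)) *
        (h v * ENNReal.ofReal ((s - v) ^ (-(1/2) : ℝ) / 2))) v) =
        {p : ℝ × ℝ | s - p.1 < p.2}.indicator (fun p => ENNReal.ofReal ((s - p.1) ^ (-(1/2) : ℝ)) *
        (h p.2 * ENNReal.ofReal ((s - p.2) ^ (-(1/2) : ℝ) / 2))) := by
      ext p
      simp [Function.uncurry, indicator]
    rw [this]
    exact Measurable.indicator (by fun_prop) (measurableSet_lt (by fun_prop) (by fun_prop))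

lemma aux_measU (m : ℕ) (E : ℝ) : MeasurableSet (simU m E) := by
  have : simU m E = (⋂ i, {x | 0 < x i}) ∩ {x | ∑ i, x i < E} := by
    ext x; simp [simU]
  rw [this]
  exact (MeasurableSet.iInter fun i => measurableSet_lt (by fun_prop) (by fun_prop)).inter
    (measurableSet_lt (by fun_prop) (by fun_prop))

lemma aux_sum (m : ℕ) (i : Fin m) (x : Fin m → ℝ) (t : ℝ) :
    ∑ j, Function.update x i t j = t + ∑ j ∈ Finset.univ \ {i}, x j :=
  Finset.sum_update_of_mem (Finset.mem_univ i) _ _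

lemma aux_mem (m : ℕ) (E : ℝ) (i : Fin m) (x : Fin m → ℝ) (t : ℝ) :
    Function.update x i t ∈ simU m E ↔
      (∀ j, j ≠ i → 0 < x j) ∧ t ∈ Ioo 0 (E - ∑ j ∈ Finset.univ \ {i}, x j) := by
  simp only [simU, mem_ofPred_eq, aux_sum, mem_Ioo]
  constructor
  · rintro ⟨h1, h2⟩
    refine ⟨fun j hj => by simpa [hj] using h1 j, by simpa using h1 i, by linarith⟩
  · rintro ⟨h1, h2, h3⟩
    refine ⟨fun j => ?_, by linarith⟩
    rcases eq_or_ne j i with rfl | hj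
    · simpa using h2
    · simpa [hj] using h1 j hj

/-- slice formula -/
lemma aux_slice (m : ℕ) (E : ℝ) (i : Fin m) (x : Fin m → ℝ) (G : (Fin m → ℝ) → ENNReal)
    (hx : ∀ j, j ≠ i → 0 < x j) :
    ∫⁻ t, (simU m E).indicator G (Function.update x i t) =
      ∫⁻ t in Ioo 0 (E - ∑ j ∈ Finset.univ \ {i}, x j), G (Function.update x i t) := by
  rw [← lintegral_indicator measurableSet_Ioo]
  refine lintegral_congr fun t => ?_
  simp only [indicator, aux_mem, eq_true hx, true_and]

lemma aux_slice' (m : ℕ) (E : ℝ) (i : Fin m) (x : Fin m → ℝ) (G : (Fin m → ℝ) → ENNReal)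
    (hx : ¬ ∀ j, j ≠ i → 0 < x j) :
    ∫⁻ t, (simU m E).indicator G (Function.update x i t) = 0 := by
  have : ∀ t, (simU m E).indicator G (Function.update x i t) = 0 := fun t =>
    indicator_of_notMem (fun h => hx ((aux_mem _ _ _ _ _).1 h).1) _
  simp [this]

lemma aux_T0meas (m : ℕ) (E : ℝ) (i : Fin m) :
    Measurable (fun p : (Fin m → ℝ) × ℝ => T0 m E i p.2 p.1) := by
  rw [measurable_pi_iff]
  intro j
  simp only [T0]
  rcases eq_or_ne j i with rfl | hj
  · simp only [Function.update_self]; fun_prop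
  · simp only [Function.update_of_ne hj]; fun_prop

lemma aux_K (m : ℕ) (E : ℝ) (i : Fin m) (F : (Fin m → ℝ) → ENNReal) (hF : Measurable F) :
    ∫⁻ x in simU m E, ENNReal.ofReal ((E - ∑ j, x j) ^ (-(1/2) : ℝ)) *
        (ENNReal.ofReal (√(x i)) * ∫⁻ u in Ioo (0:ℝ) 1, F (T0 m E i u x)) =
    ∫⁻ x in simU m E, ENNReal.ofReal ((E - ∑ j, x j) ^ (-(1/2) : ℝ)) *
        (ENNReal.ofReal (√(x i)) * F x) := by
  rw [← lintegral_indicator (aux_measU m E), ← lintegral_indicator (aux_measU m E)]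
  have hm1 : Measurable (fun x : Fin m → ℝ => ∫⁻ u in Ioo (0:ℝ) 1, F (T0 m E i u x)) :=
    (hF.comp (aux_T0meas m E i)).lintegral_prod_right'
  refine lintegral_eq_of_lmarginal_eq (μ := fun _ : Fin m => (volume : Measure ℝ)) {i} ?_ ?_ ?_
  · exact Measurable.indicator (by fun_prop) (aux_measU m E)
  · exact Measurable.indicator (by fun_prop) (aux_measU m E)
  · rw [lmarginal_singleton, lmarginal_singleton]
    ext x
    by_cases hx : ∀ j, j ≠ i → 0 < x j
    · rw [aux_slice _ _ _ _ _ hx, aux_slice _ _ _ _ _ hx]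
      have key := aux_L2 (E - ∑ j ∈ Finset.univ \ {i}, x j) (fun t => F (Function.update x i t))
        (hF.comp (measurable_update x))
      have e1 : ∀ t, E - ∑ j, Function.update x i t j = E - ∑ j ∈ Finset.univ \ {i}, x j - t := by
        intro t; rw [aux_sum]; ring
      have e2 : ∀ t u, T0 m E i u (Function.update x i t) =
          Function.update x i (E - ∑ j ∈ Finset.univ \ {i}, x j - u ^ 2 * t) := by
        intro t u
        simp only [T0, e1, Function.update_self, Function.update_idem]
        congr 1; ring
      simp only [e1, e2, Function.update_self]
      exact key
    · rw [aux_slice' _ _ _ _ _ hx, aux_slice' _ _ _ _ _ hx]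

lemma aux_tank (m : ℕ) (E : ℝ) :
    Measurable (fun x : Delta m E => ENNReal.ofReal ((tank m E x) ^ (-(1/2) : ℝ))) := by
  unfold tank
  have : Measurable (fun x : Fin m → ℝ => ENNReal.ofReal ((E - ∑ j, x j) ^ (-(1/2) : ℝ))) := by
    fun_prop
  exact this.comp measurable_subtype_coe

lemma aux_int (m : ℕ) (E : ℝ) (F : (Fin m → ℝ) → ENNReal) (hF : Measurable F) :
    ∫⁻ x, F x.1 ∂(piPre m E) =
      ∫⁻ x in simU m E, ENNReal.ofReal ((E - ∑ j, x j) ^ (-(1/2) : ℝ)) * F x := by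
  have hF' : Measurable (fun x : Delta m E => F x.1) := hF.comp measurable_subtype_coe
  rw [piPre, lintegral_withDensity_eq_lintegral_mul _ (aux_tank m E) hF', ← lintegral_subtype_comap (aux_measU m E)]
  rfl

lemma aux_fin (m : ℕ) (hm : 1 ≤ m) (E : ℝ) (hE : 0 < E) : piPre m E univ ≠ ⊤ := by
  rw [← lintegral_one, aux_int m E (fun _ => 1) measurable_const]
  rw [← lintegral_indicator (aux_measU m E)]
  let i : Fin m := ⟨0, hm⟩
  let B : Set (Fin m → ℝ) := univ.pi (fun _ => Ioo 0 E)
  have hB : MeasurableSet B := MeasurableSet.univ_pi (fun _ => measurableSet_Ioo)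
  have hle := lintegral_le_of_lmarginal_le (μ := fun _ : Fin m => (volume : Measure ℝ)) {i}
    (f := (simU m E).indicator
      (fun x => ENNReal.ofReal ((E - ∑ j, x j) ^ (-(1/2) : ℝ)) * 1))
    (g := B.indicator (fun _ => ENNReal.ofReal (2 * √E / E)))
    (Measurable.indicator (by fun_prop) (aux_measU m E)) (measurable_const.indicator hB) ?_
  · refine ne_top_of_le_ne_top ?_ hle
    rw [lintegral_indicator hB, setLIntegral_const, Measure.pi_pi]
    refine ENNReal.mul_ne_top ENNReal.ofReal_ne_top ?_
    simp
  · rw [lmarginal_singleton, lmarginal_singleton]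
    intro x
    simp only
    by_cases hx : ∀ j, j ≠ i → 0 < x j
    · rw [aux_slice _ _ _ _ _ hx]
      have e1 : ∀ t, E - ∑ j, Function.update x i t j = E - ∑ j ∈ Finset.univ \ {i}, x j - t := by
        intro t; rw [aux_sum]; ring
      simp only [e1, mul_one]
      have hnn : ∀ j ∈ Finset.univ \ {i}, 0 ≤ x j := fun j hj => (hx j (by simpa using hj)).le
      have hs0 := Finset.sum_nonneg hnn
      by_cases hs : 0 < E - ∑ j ∈ Finset.univ \ {i}, x j
      · rw [aux_L0 _ _ hs.le]
        have hb : ∀ t, B.indicator (fun _ => ENNReal.ofReal (2 * √E / E)) (Function.update x i t) =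
            (Ioo 0 E).indicator (fun _ => ENNReal.ofReal (2 * √E / E)) t := by
          intro t
          simp only [indicator]
          congr 1
          apply propext
          constructor
          · intro h; simpa using h i (mem_univ i)
          · intro h j _
            rcases eq_or_ne j i with rfl | hj
            · simpa using h
            · have hj2 := Finset.single_le_sum hnn (show j ∈ Finset.univ \ {i} by simpa using hj)
              simp only [Function.update_of_ne hj]
              exact ⟨hx j hj, by linarith⟩
        simp only [hb]
        rw [lintegral_indicator measurableSet_Ioo, setLIntegral_const, Real.volume_Ioo,
          ← ENNReal.ofReal_mul (by positivity)]
        apply ENNReal.ofReal_le_ofReal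
        have : 2 * √E / E * (E - 0) = 2 * √E := by field_simp; ring
        rw [this]
        gcongr
        linarith
      · rw [Ioo_eq_empty hs]; simp
    · rw [aux_slice' _ _ _ _ _ hx]; exact zero_le

lemma aux_pos (m : ℕ) (hm : 1 ≤ m) (E : ℝ) (hE : 0 < E) : piPre m E univ ≠ 0 := by
  rw [← lintegral_one, aux_int m E (fun _ => 1) measurable_const]
  have hop : IsOpen (simU m E) := by
    have : simU m E = (⋂ i, {x | 0 < x i}) ∩ {x | ∑ i, x i < E} := by
      ext x; simp [simU]
    rw [this]
    exact (isOpen_iInter_of_finite fun i => isOpen_lt (by fun_prop) (by fun_prop)).inter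
      (isOpen_lt (by fun_prop) (by fun_prop))
  have hne : (simU m E).Nonempty := by
    have hm' : (0:ℝ) < m := by exact_mod_cast hm
    refine ⟨fun _ => E / (2 * m), fun i => by positivity, ?_⟩
    simp only [Finset.sum_const, Finset.card_univ, Fintype.card_fin, nsmul_eq_mul]
    have : (m:ℝ) * (E / (2 * m)) = E / 2 := by field_simp
    rw [this]; linarith
  refine ((setLIntegral_pos_iff (by fun_prop)).2 ?_).ne'
  refine lt_of_lt_of_le (hop.measure_pos volume hne) (measure_mono ?_)
  intro x hx
  refine ⟨?_, hx⟩
  simp only [Function.mem_support, mul_one]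
  exact (ENNReal.ofReal_pos.2 (Real.rpow_pos_of_pos (by linarith [hx.2]) _)).ne'

lemma aux_Tmeas (m : ℕ) (E : ℝ) (i : Fin m) :
    Measurable (fun p : Delta m E × ℝ => Texch m E i p.2 p.1) := by
  rw [← (MeasurableEmbedding.subtype_coe (aux_measU m E)).measurable_comp_iff]
  have : (Subtype.val ∘ fun p : Delta m E × ℝ => Texch m E i p.2 p.1) =
      fun p => if p.2 ∈ Ioo (0:ℝ) 1 then T0 m E i p.2 p.1.1 else p.1.1 := by
    ext1 p
    simp only [Function.comp, Texch]
    split_ifs <;> rfl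
  rw [this]
  refine Measurable.ite (measurable_snd measurableSet_Ioo) ?_ (by fun_prop)
  exact (aux_T0meas m E i).comp
    ((measurable_subtype_coe.comp measurable_fst).prodMk measurable_snd)

instance aux_sf : SFinite unif01 := by unfold unif01; infer_instance

lemma aux_Tmeas1 (m : ℕ) (E : ℝ) (i : Fin m) (x : Delta m E) :
    Measurable (fun u => Texch m E i u x) :=
  (aux_Tmeas m E i).comp (measurable_const.prodMk measurable_id)

lemma aux_sqrtmeas (m : ℕ) (E : ℝ) (i : Fin m) :
    Measurable (fun x : Delta m E => ENNReal.ofReal (√(x.1 i))) := by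
  have : Measurable (fun x : Fin m → ℝ => ENNReal.ofReal (√(x i))) := by fun_prop
  exact this.comp measurable_subtype_coe

lemma aux_ratemeas (m : ℕ) (E : ℝ) :
    Measurable (fun x : Delta m E => ENNReal.ofReal (1 - jumpRate m E x / Lam m E)) := by
  have : Measurable (fun x : Fin m → ℝ =>
    ENNReal.ofReal (1 - (∑ i, √(x i)) / Lam m E)) := by fun_prop
  exact this.comp measurable_subtype_coe

lemma aux_innermeas (m : ℕ) (E : ℝ) (i : Fin m) (f : Delta m E → ENNReal) (hf : Measurable f) :
    Measurable (fun x : Delta m E => ∫⁻ u, f (Texch m E i u x) ∂unif01) :=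
  (hf.comp (aux_Tmeas m E i)).lintegral_prod_right'

lemma aux_ustep_int (m : ℕ) (E : ℝ) (x : Delta m E) (f : Delta m E → ENNReal) (hf : Measurable f) :
    ∫⁻ z, f z ∂(ustep m E x) = ENNReal.ofReal (1 - jumpRate m E x / Lam m E) * f x +
      (ENNReal.ofReal (Lam m E))⁻¹ * ∑ i, ENNReal.ofReal (√(x.1 i)) *
        ∫⁻ u, f (Texch m E i u x) ∂unif01 := by
  rw [ustep, lintegral_add_measure, lintegral_smul_measure, lintegral_smul_measure,
    lintegral_dirac' _ hf, lintegral_sum_measure, tsum_fintype]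
  simp only [lintegral_smul_measure, smul_eq_mul]
  congr 3
  ext i
  rw [lintegral_map hf (aux_Tmeas1 m E i x)]

lemma aux_ustep_meas (m : ℕ) (E : ℝ) : Measurable (ustep m E) := by
  refine Measure.measurable_of_measurable_coe _ fun s hs => ?_
  have hf : Measurable (s.indicator (1 : Delta m E → ENNReal)) := measurable_one.indicator hs
  simp_rw [← lintegral_indicator_one hs, aux_ustep_int m E _ _ hf]
  refine ((aux_ratemeas m E).mul hf).add (Measurable.const_mul ?_ _)
  exact Finset.measurable_sum _ fun i _ => (aux_sqrtmeas m E i).mul (aux_innermeas m E i _ hf)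

lemma aux_K2 (m : ℕ) (E : ℝ) (i : Fin m) (f : Delta m E → ENNReal) (hf : Measurable f) :
    ∫⁻ x, ENNReal.ofReal (√(x.1 i)) * ∫⁻ u, f (Texch m E i u x) ∂unif01 ∂(piPre m E) =
    ∫⁻ x, ENNReal.ofReal (√(x.1 i)) * f x ∂(piPre m E) := by
  have hemb := MeasurableEmbedding.subtype_coe (aux_measU m E)
  let F : (Fin m → ℝ) → ENNReal := Function.extend Subtype.val f 0
  have hF : Measurable F := hemb.measurable_extend hf measurable_zero
  have hFf : ∀ x : Delta m E, F x.1 = f x := fun x => Subtype.val_injective.extend_apply f 0 x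
  have hm1 : Measurable (fun x : Fin m → ℝ => ∫⁻ u in Ioo (0:ℝ) 1, F (T0 m E i u x)) :=
    (hF.comp (aux_T0meas m E i)).lintegral_prod_right'
  have e1 : ∀ x : Delta m E, ∫⁻ u, f (Texch m E i u x) ∂unif01 =
      ∫⁻ u in Ioo (0:ℝ) 1, F (T0 m E i u x.1) := by
    intro x
    refine setLIntegral_congr_fun measurableSet_Ioo fun u hu => ?_
    simp only [← hFf, Texch, dif_pos hu]
  simp_rw [e1, ← hFf]
  rw [aux_int m E (fun x => ENNReal.ofReal (√(x i)) * ∫⁻ u in Ioo (0:ℝ) 1, F (T0 m E i u x))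
    (by fun_prop), aux_int m E (fun x => ENNReal.ofReal (√(x i)) * F x) (by fun_prop)]
  exact aux_K m E i F hF

lemma aux_weights (m : ℕ) (hm : 1 ≤ m) (E : ℝ) (hE : 0 < E) (x : Delta m E) :
    ENNReal.ofReal (1 - jumpRate m E x / Lam m E) +
      (ENNReal.ofReal (Lam m E))⁻¹ * ∑ i, ENNReal.ofReal (√(x.1 i)) = 1 := by
  have hm' : (0:ℝ) < m := by exact_mod_cast hm
  have hL : 0 < Lam m E := Real.sqrt_pos.2 (by positivity)
  have hle : jumpRate m E x ≤ Lam m E := by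
    apply Real.le_sqrt_of_sq_le
    have h1 := sq_sum_le_card_mul_sum_sq (s := Finset.univ) (f := fun i => √(x.1 i))
    have h2 : ∑ i, √(x.1 i) ^ 2 = ∑ i, x.1 i :=
      Finset.sum_congr rfl fun i _ => Real.sq_sqrt (x.2.1 i).le
    rw [h2] at h1
    simp only [Finset.card_univ, Fintype.card_fin] at h1
    exact h1.trans (mul_le_mul_of_nonneg_left x.2.2.le hm'.le)
  have h0 : 0 ≤ jumpRate m E x := Finset.sum_nonneg fun i _ => Real.sqrt_nonneg _
  rw [← ENNReal.ofReal_sum_of_nonneg (fun i _ => Real.sqrt_nonneg _), ← ENNReal.ofReal_inv_of_pos hL,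
    ← ENNReal.ofReal_mul (by positivity), ← ENNReal.ofReal_add]
  · rw [← ENNReal.ofReal_one]
    congr 1
    change 1 - jumpRate m E x / Lam m E + (Lam m E)⁻¹ * jumpRate m E x = 1
    ring
  · rw [sub_nonneg, div_le_one hL]; exact hle
  · exact mul_nonneg (by positivity) h0

lemma aux_inv (m : ℕ) (hm : 1 ≤ m) (E : ℝ) (hE : 0 < E) :
    (piPre m E).bind (ustep m E) = piPre m E := by
  ext s hs
  have hf : Measurable (s.indicator (1 : Delta m E → ENNReal)) := measurable_one.indicator hs
  rw [Measure.bind_apply hs (aux_ustep_meas m E).aemeasurable]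
  conv_rhs => rw [← lintegral_indicator_one hs]
  simp_rw [← lintegral_indicator_one hs, aux_ustep_int m E _ _ hf]
  generalize s.indicator (1 : Delta m E → ENNReal) = f at hf
  have hmS : ∀ i, Measurable (fun x : Delta m E => ENNReal.ofReal (√(x.1 i)) *
      ∫⁻ u, f (Texch m E i u x) ∂unif01) :=
    fun i => (aux_sqrtmeas m E i).mul (aux_innermeas m E i _ hf)
  have hmS' : ∀ i, Measurable (fun x : Delta m E => ENNReal.ofReal (√(x.1 i)) * f x) :=
    fun i => (aux_sqrtmeas m E i).mul hf
  have hR : Measurable (fun x : Delta m E =>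
      ENNReal.ofReal (1 - jumpRate m E x / Lam m E) * f x) := (aux_ratemeas m E).mul hf
  rw [lintegral_add_left hR,
    lintegral_const_mul _ (Finset.measurable_fun_sum _ fun i _ => hmS i),
    lintegral_finsetSum _ fun i _ => hmS i]
  simp_rw [aux_K2 m E _ f hf]
  rw [← lintegral_finsetSum _ fun i _ => hmS' i,
    ← lintegral_const_mul _ (Finset.measurable_fun_sum _ fun i _ => hmS' i),
    ← lintegral_add_left hR]
  refine lintegral_congr fun x => ?_
  rw [← Finset.sum_mul, ← mul_assoc, ← add_mul, aux_weights m hm E hE, one_mul]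

lemma aux_iter_meas (m : ℕ) (E : ℝ) (n : ℕ) : Measurable (ustepIter m E n) := by
  induction n with
  | zero => exact Measure.measurable_dirac
  | succ n ih => exact (Measure.measurable_bind' ih).comp (aux_ustep_meas m E)

lemma aux_iter_inv (m : ℕ) (E : ℝ) (μ : Measure (Delta m E)) (hμ : μ.bind (ustep m E) = μ)
    (n : ℕ) : μ.bind (ustepIter m E n) = μ := by
  induction n with
  | zero => exact Measure.bind_dirac
  | succ n ih =>
    have := Measure.bind_bind (m := μ) (aux_ustep_meas m E).aemeasurable
      (aux_iter_meas m E n).aemeasurable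
    rw [hμ, ih] at this
    exact this.symm

lemma aux_Pt_apply (m : ℕ) (E t : ℝ) (x : Delta m E) (s : Set (Delta m E)) (hs : MeasurableSet s) :
    Pt m E t x s = ∑' n : ℕ, ENNReal.ofReal
      (Real.exp (-(Lam m E) * t) * ((Lam m E) * t) ^ n / n.factorial) * ustepIter m E n x s := by
  rw [Pt, Measure.sum_apply _ hs]
  rfl

lemma aux_Pt_inv (m : ℕ) (E : ℝ) (μ : Measure (Delta m E)) (hμ : μ.bind (ustep m E) = μ)
    (t : ℝ) (ht : 0 ≤ t) : μ.bind (Pt m E t) = μ := by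
  have hcoe : ∀ n (s : Set (Delta m E)), MeasurableSet s →
      Measurable (fun x => ustepIter m E n x s) := fun n s hs =>
    (Measure.measurable_coe hs).comp (aux_iter_meas m E n)
  have hmeas : Measurable (Pt m E t) := by
    refine Measure.measurable_of_measurable_coe _ fun s hs => ?_
    simp_rw [aux_Pt_apply m E t _ s hs]
    exact Measurable.tsum fun n => (hcoe n s hs).const_mul _
  ext s hs
  rw [Measure.bind_apply hs hmeas.aemeasurable]
  simp_rw [aux_Pt_apply m E t _ s hs]
  rw [lintegral_tsum fun n => ((hcoe n s hs).const_mul _).aemeasurable]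
  have e1 : ∀ n, ∫⁻ x, ustepIter m E n x s ∂μ = μ s := fun n => by
    rw [← Measure.bind_apply hs (aux_iter_meas m E n).aemeasurable, aux_iter_inv m E μ hμ n]
  simp_rw [fun n => lintegral_const_mul (μ := μ) (ENNReal.ofReal
      (Real.exp (-(Lam m E) * t) * ((Lam m E) * t) ^ n / n.factorial)) (hcoe n s hs), e1]
  rw [ENNReal.tsum_mul_right]
  have hL : 0 ≤ Lam m E := Real.sqrt_nonneg _
  have hs1 : HasSum (fun n : ℕ => Real.exp (-(Lam m E) * t) * ((Lam m E) * t) ^ n / n.factorial)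
      1 := by
    have := (NormedSpace.expSeries_div_hasSum_exp (𝔸 := ℝ) (Lam m E * t)).mul_left
      (Real.exp (-(Lam m E) * t))
    rw [← Real.exp_eq_exp_ℝ, ← Real.exp_add] at this
    simpa [mul_div_assoc] using this
  rw [← ENNReal.ofReal_tsum_of_nonneg (fun n => by positivity) hs1.summable, hs1.tsum_eq]
  simp

/-- Proposition 1. The probability measure `π` with density
`Z⁻¹ y^{-1/2}` w.r.t. Lebesgue measure on `U` (`Z = ∫_U y^{-1/2} dx` being a finite
normalizing constant) is an invariant measure of the energy-exchange process:
`π P^t = π` for every `t ≥ 0`. -/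
theorem pi_invariant (m : ℕ) (hm : 1 ≤ m) (E : ℝ) (hE : 0 < E) :
    (piPre m E Set.univ ≠ 0 ∧ piPre m E Set.univ ≠ ⊤) ∧
    IsProbabilityMeasure (piMeasure m E) ∧
    ∀ t : ℝ, 0 ≤ t → (piMeasure m E).bind (Pt m E t) = piMeasure m E := by
  have h0 := aux_pos m hm E hE
  have h1 := aux_fin m hm E hE
  refine ⟨⟨h0, h1⟩, ⟨?_⟩, fun t ht => aux_Pt_inv m E _ ?_ t ht⟩
  · simp only [piMeasure, Measure.smul_apply, smul_eq_mul]
    exact ENNReal.inv_mul_cancel h0 h1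
  · ext s hs
    rw [Measure.bind_apply hs (aux_ustep_meas m E).aemeasurable, piMeasure,
      lintegral_smul_measure, ← Measure.bind_apply hs (aux_ustep_meas m E).aemeasurable,
      aux_inv m hm E hE]
    rfl
end

section
/- The measure π is the unique invariant probability measure of the energy-exchange process: if μ is any Borel probability measure on Δ with μP^t = μ for all t > 0, then μ = π. Consequently π is ergodic. -/
open MeasureTheory Set Filter

noncomputable section
namespace EEx

def tk (E : ℝ) {m : ℕ} (x : Fin m → ℝ) : ℝ := E - ∑ j, x j

lemma sum_upd {m : ℕ} (x : Fin m → ℝ) (i : Fin m) (v : ℝ) :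
    ∑ j, Function.update x i v j = ∑ j, x j - x i + v := by
  rw [Finset.sum_update_of_mem (Finset.mem_univ i), ← Finset.erase_eq,
    Finset.sum_erase_eq_sub (Finset.mem_univ i)]
  ring

lemma tk_upd {m : ℕ} (E : ℝ) (x : Fin m → ℝ) (i : Fin m) (v : ℝ) :
    tk E (Function.update x i v) = tk E x + x i - v := by
  unfold tk; rw [sum_upd]; ring

def swapL {m : ℕ} (i : Fin m) : ((Fin m → ℝ) × ℝ) →ₗ[ℝ] ((Fin m → ℝ) × ℝ) where
  toFun p := (Function.update p.1 i p.2, p.1 i)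
  map_add' p q := by
    ext j
    · by_cases h : j = i
      · subst h; simp
      · simp [Function.update_of_ne h]
    · simp
  map_smul' c p := by
    ext j
    · by_cases h : j = i
      · subst h; simp
      · simp [Function.update_of_ne h]
    · simp

lemma swapL_apply {m : ℕ} (i : Fin m) (p : (Fin m → ℝ) × ℝ) :
    swapL i p = (Function.update p.1 i p.2, p.1 i) := rfl

lemma swapL_invol {m : ℕ} (i : Fin m) : swapL i ∘ₗ swapL i = LinearMap.id := by
  apply LinearMap.ext
  intro p
  simp [swapL_apply]

lemma swap_mp {m : ℕ} (i : Fin m) :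
    MeasurePreserving (fun p : (Fin m → ℝ) × ℝ => (Function.update p.1 i p.2, p.1 i))
      (volume.prod volume) (volume.prod volume) := by
  have hdet : LinearMap.det (swapL i) * LinearMap.det (swapL i) = 1 := by
    rw [← LinearMap.det_comp, swapL_invol, LinearMap.det_id]
  have hne : LinearMap.det (swapL i) ≠ 0 := by
    intro h; rw [h] at hdet; simp at hdet
  have habs : |(LinearMap.det (swapL i))⁻¹| = 1 := by
    rcases mul_self_eq_one_iff.1 hdet with h | h <;> simp [h]
  have h := Measure.map_linearMap_addHaar_eq_smul_addHaar
    ((volume : Measure (Fin m → ℝ)).prod (volume : Measure ℝ)) hne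
  rw [habs] at h
  refine ⟨(swapL i).continuous_of_finiteDimensional.measurable, ?_⟩
  rw [ENNReal.ofReal_one, one_smul] at h
  exact h

lemma meas_tk {m : ℕ} (E : ℝ) : Measurable (fun x : Fin m → ℝ => tk E x) := by
  unfold tk; fun_prop

lemma cont_tk {m : ℕ} (E : ℝ) : Continuous (fun x : Fin m → ℝ => tk E x) := by
  unfold tk; fun_prop

lemma mem_simU {m : ℕ} {E : ℝ} {x : Fin m → ℝ} :
    x ∈ simU m E ↔ (∀ i, 0 < x i) ∧ 0 < tk E x := by
  simp [simU, tk]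

lemma isOpen_simU (m : ℕ) (E : ℝ) : IsOpen (simU m E) := by
  have : simU m E = (⋂ i, {x : Fin m → ℝ | 0 < x i}) ∩ {x | 0 < tk E x} := by
    ext x; simp [mem_simU]
  rw [this]
  exact (isOpen_iInter_of_finite fun i => isOpen_lt continuous_const (continuous_apply i)).inter
    (isOpen_lt continuous_const (cont_tk E))

/-- allowed move -/
def cond (E : ℝ) {m : ℕ} (x : Fin m → ℝ) (i : Fin m) (v : ℝ) : Prop :=
  x ∈ simU m E ∧ v ∈ Ioo (tk E x) (tk E x + x i)

lemma cond_upd {m : ℕ} {E : ℝ} {x : Fin m → ℝ} {i : Fin m} {v : ℝ} (h : cond E x i v) :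
    cond E (Function.update x i v) i (x i) := by
  obtain ⟨hx, h1, h2⟩ := h
  rw [mem_simU] at hx
  refine ⟨mem_simU.2 ⟨fun j => ?_, ?_⟩, ?_, ?_⟩
  · by_cases h : j = i
    · subst h; simp; linarith [hx.2]
    · simpa [Function.update_of_ne h] using hx.1 j
  · rw [tk_upd]; linarith
  · rw [tk_upd]; linarith
  · rw [tk_upd]; simp; linarith [hx.2]

lemma cond_mem {m : ℕ} {E : ℝ} {x : Fin m → ℝ} {i : Fin m} {v : ℝ} (h : cond E x i v) :
    Function.update x i v ∈ simU m E := (cond_upd h).1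

lemma cond_upd_iff {m : ℕ} {E : ℝ} {x : Fin m → ℝ} {i : Fin m} {v : ℝ} :
    cond E (Function.update x i v) i (x i) ↔ cond E x i v := by
  refine ⟨fun h => ?_, cond_upd⟩
  have := cond_upd h
  simpa using this

lemma isOpen_cond {m : ℕ} (E : ℝ) (i : Fin m) :
    IsOpen {p : (Fin m → ℝ) × ℝ | cond E p.1 i p.2} := by
  have h := cont_tk (m := m) E
  refine ((isOpen_simU m E).preimage continuous_fst).inter
    ((isOpen_lt (h.comp continuous_fst) continuous_snd).inter
      (isOpen_lt continuous_snd ((h.comp continuous_fst).add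
        ((continuous_apply i).comp continuous_fst))))

lemma cont_upd {m : ℕ} (i : Fin m) :
    Continuous (fun p : (Fin m → ℝ) × ℝ => Function.update p.1 i p.2) := by
  fun_prop

/-- Double integral symmetry. -/
lemma dsymm {m : ℕ} (E : ℝ) (i : Fin m) (F : (Fin m → ℝ) → (Fin m → ℝ) → ENNReal)
    (hF : Measurable (Function.uncurry F)) :
    ∫⁻ x in simU m E, ∫⁻ v in Ioo (tk E x) (tk E x + x i), F x (Function.update x i v)
    = ∫⁻ x in simU m E, ∫⁻ v in Ioo (tk E x) (tk E x + x i), F (Function.update x i v) x := by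
  have hu := (cont_upd i (m := m)).measurable
  have key : ∀ G : (Fin m → ℝ) → (Fin m → ℝ) → ENNReal, Measurable (Function.uncurry G) →
      ∫⁻ x in simU m E, ∫⁻ v in Ioo (tk E x) (tk E x + x i), G x (Function.update x i v)
      = ∫⁻ p, {p : (Fin m → ℝ) × ℝ | cond E p.1 i p.2}.indicator
          (fun p => G p.1 (Function.update p.1 i p.2)) p ∂((volume : Measure (Fin m → ℝ)).prod (volume : Measure ℝ)) := by
    intro G hG
    have hm : Measurable (fun p : (Fin m → ℝ) × ℝ => G p.1 (Function.update p.1 i p.2)) :=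
      hG.comp (measurable_fst.prodMk hu)
    rw [lintegral_prod _ (hm.indicator (isOpen_cond E i).measurableSet).aemeasurable,
      ← lintegral_indicator (isOpen_simU m E).measurableSet]
    congr 1
    ext x
    by_cases hx : x ∈ simU m E
    · rw [indicator_of_mem hx, ← lintegral_indicator measurableSet_Ioo]
      congr 1
      ext v
      by_cases hv : v ∈ Ioo (tk E x) (tk E x + x i)
      · rw [indicator_of_mem hv, indicator_of_mem]; exact ⟨hx, hv⟩
      · rw [indicator_of_notMem hv, indicator_of_notMem]; exact fun h => hv h.2
    · rw [indicator_of_notMem hx]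
      symm
      rw [lintegral_eq_zero_iff']
      · refine Eventually.of_forall fun v => ?_
        exact indicator_of_notMem (fun h => hx h.1) _
      · exact ((hm.indicator (isOpen_cond E i).measurableSet).comp measurable_prodMk_left).aemeasurable
  rw [key F hF, key (fun a b => F b a) (hF.comp measurable_swap)]
  have hm : Measurable (fun p : (Fin m → ℝ) × ℝ => F p.1 (Function.update p.1 i p.2)) :=
    hF.comp (measurable_fst.prodMk hu)
  rw [← (swap_mp i).lintegral_comp (hm.indicator (isOpen_cond E i).measurableSet)]
  congr 1
  ext p
  by_cases h : cond E p.1 i p.2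
  · rw [indicator_of_mem, indicator_of_mem]
    · simp
    · exact h
    · exact cond_upd_iff.2 h
  · rw [indicator_of_notMem, indicator_of_notMem]
    · exact h
    · exact fun h' => h (cond_upd_iff.1 h')

/-- slice lemma -/
lemma slice {m : ℕ} (i : Fin m) (S : Set (Fin m → ℝ)) (hS : MeasurableSet S)
    (h : ∀ᵐ w : Fin m → ℝ, ∀ᵐ v : ℝ, Function.update w i v ∈ S) : ∀ᵐ w : Fin m → ℝ, w ∈ S := by
  have h1 : ∀ᵐ p ∂((volume : Measure (Fin m → ℝ)).prod (volume : Measure ℝ)),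
      Function.update p.1 i p.2 ∈ S := by
    rw [Measure.ae_prod_iff_ae_ae]
    · exact h
    · exact (cont_upd i).measurable hS
  have h2 := (swap_mp i).quasiMeasurePreserving.ae h1
  have h3 := Measure.ae_ae_of_ae_prod h2
  filter_upwards [h3] with w hw
  obtain ⟨v, hv⟩ := hw.exists
  simpa using hv

end EEx
end

noncomputable section
namespace EEx

/-- absorbing set -/
def Absb (E : ℝ) {m : ℕ} (N : Set (Fin m → ℝ)) : Prop :=
  ∀ x ∈ N, ∀ i, ∀ᵐ v : ℝ, cond E x i v → Function.update x i v ∈ N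

/-- locally full points -/
def Wset (E : ℝ) {m : ℕ} (N : Set (Fin m → ℝ)) : Set (Fin m → ℝ) :=
  {q | ∃ O : Set (Fin m → ℝ), IsOpen O ∧ q ∈ O ∧ O ⊆ simU m E ∧ volume (O \ N) = 0}

lemma step1 {m : ℕ} {E : ℝ} {N : Set (Fin m → ℝ)} (hN : MeasurableSet N)
    (hNU : N ⊆ simU m E) (hA : Absb E N) {x : Fin m → ℝ} (hx : x ∈ N) (s : Finset (Fin m)) :
    ∃ O : Set (Fin m → ℝ), IsOpen O ∧ O ⊆ simU m E ∧ (∃ w, s.piecewise w x ∈ O) ∧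
      ∀ᵐ w : Fin m → ℝ, s.piecewise w x ∈ O → s.piecewise w x ∈ N := by
  classical
  induction s using Finset.induction_on with
  | empty =>
    refine ⟨simU m E, isOpen_simU m E, subset_rfl, ⟨x, by simpa using hNU hx⟩, ?_⟩
    simp [hx]
  | insert k s hk ih =>
    obtain ⟨O, hO, hOU, ⟨w0, hw0⟩, hae⟩ := ih
    have hpc : Continuous (fun z : Fin m → ℝ => Function.update z k (x k)) := by fun_prop
    have e0 : ∀ w : Fin m → ℝ, Function.update ((insert k s).piecewise w x) k (x k)
        = s.piecewise w x := by
      intro w; ext j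
      by_cases h : j = k
      · subst h; simp [hk]
      · by_cases h2 : j ∈ s <;> simp [h, h2]
    have e1 : ∀ (w : Fin m → ℝ), (insert k s).piecewise w x
        = Function.update (s.piecewise w x) k (w k) := by
      intro w; ext j
      by_cases h : j = k
      · subst h; simp
      · by_cases h2 : j ∈ s <;> simp [h, h2]
    have e2 : ∀ (w : Fin m → ℝ) v, s.piecewise (Function.update w k v) x = s.piecewise w x := by
      intro w v; ext j
      by_cases h2 : j ∈ s
      · have h : j ≠ k := fun h => hk (h ▸ h2)
        simp [h, h2]
      · simp [h2]
    refine ⟨simU m E ∩ {z | Function.update z k (x k) ∈ O ∧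
      cond E (Function.update z k (x k)) k (z k)}, ?_, inter_subset_left, ?_, ?_⟩
    · refine (isOpen_simU m E).inter ((hO.preimage hpc).inter ?_)
      exact (isOpen_cond E k).preimage (hpc.prodMk (continuous_apply k))
    · set p := s.piecewise w0 x with hp
      have hpU := mem_simU.1 (hOU hw0)
      set v := tk E p + p k / 2
      have hc : cond E p k v := ⟨hOU hw0, by
        constructor <;> simp only [v] <;> linarith [hpU.1 k]⟩
      refine ⟨Function.update w0 k v, ?_⟩
      have h3 : (insert k s).piecewise (Function.update w0 k v) x = Function.update p k v := by
        rw [e1, e2]; simp [hp]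
      refine ⟨by rw [h3]; exact cond_mem hc, ?_⟩
      simp only [mem_ofPred_eq]
      rw [e0, e2, ← hp, h3]
      exact ⟨hw0, by simpa using hc⟩
    · have hpw : Measurable (fun w : Fin m → ℝ => (insert k s).piecewise w x) := by
        refine measurable_pi_lambda _ fun j => ?_
        by_cases h : j ∈ insert k s
        · simpa only [Finset.piecewise_eq_of_mem _ _ _ h] using measurable_pi_apply j
        · simpa only [Finset.piecewise_eq_of_notMem _ _ _ h] using measurable_const
      have hOm : MeasurableSet (simU m E ∩ {z | Function.update z k (x k) ∈ O ∧
          cond E (Function.update z k (x k)) k (z k)}) := by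
        refine IsOpen.measurableSet ?_
        refine (isOpen_simU m E).inter ((hO.preimage hpc).inter ?_)
        exact (isOpen_cond E k).preimage (hpc.prodMk (continuous_apply k))
      refine slice k {w | (insert k s).piecewise w x ∈ simU m E ∩ {z | Function.update z k (x k) ∈ O ∧
          cond E (Function.update z k (x k)) k (z k)} → (insert k s).piecewise w x ∈ N} ?_ ?_
      · have := (hpw hOm).compl.union (hpw hN)
        convert this using 1
        ext w
        simp only [mem_ofPred_eq, mem_union, mem_compl_iff, mem_preimage]
        tauto
      · filter_upwards [hae] with w hw
        by_cases hwO : s.piecewise w x ∈ O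
        · filter_upwards [hA _ (hw hwO) k] with v hv
          intro h
          have h2 : Function.update ((insert k s).piecewise (Function.update w k v) x) k (x k) ∈ O ∧
            cond E (Function.update ((insert k s).piecewise (Function.update w k v) x) k (x k)) k
              ((insert k s).piecewise (Function.update w k v) x k) := h.2
          rw [e0, e2] at h2
          rw [e1, e2]
          have h4 := h2.2
          rw [e1, e2] at h4
          simp only [Function.update_self] at h4 ⊢
          exact hv h4
        · refine Eventually.of_forall fun v => ?_
          intro h
          have h2 : Function.update ((insert k s).piecewise (Function.update w k v) x) k (x k) ∈ O ∧
            cond E (Function.update ((insert k s).piecewise (Function.update w k v) x) k (x k)) k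
              ((insert k s).piecewise (Function.update w k v) x k) := h.2
          rw [e0, e2] at h2
          exact absurd h2.1 hwO

lemma W_nonempty {m : ℕ} {E : ℝ} {N : Set (Fin m → ℝ)} (hN : MeasurableSet N)
    (hNU : N ⊆ simU m E) (hA : Absb E N) {x : Fin m → ℝ} (hx : x ∈ N) :
    (Wset E N).Nonempty := by
  obtain ⟨O, hO, hOU, ⟨w, hw⟩, h⟩ := step1 hN hNU hA hx Finset.univ
  simp only [Finset.piecewise_univ] at hw h
  refine ⟨w, O, hO, hw, hOU, ?_⟩
  rw [ae_iff] at h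
  convert h using 2
  ext z; simp

lemma null_ae {m : ℕ} {E : ℝ} (i : Fin m) {A B : Set (Fin m → ℝ)} (hA : MeasurableSet A)
    (hB : MeasurableSet B)
    (h : ∀ᵐ x : Fin m → ℝ, x ∈ A → ∀ᵐ v : ℝ, cond E x i v → Function.update x i v ∉ B) :
    ∀ᵐ x : Fin m → ℝ, x ∈ B → ∀ᵐ v : ℝ, cond E x i v → Function.update x i v ∉ A := by
  have key : ∀ {A B : Set (Fin m → ℝ)} (_ : MeasurableSet A) (_ : MeasurableSet B),
      (∫⁻ x in simU m E, ∫⁻ v in Ioo (tk E x) (tk E x + x i),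
        A.indicator 1 x * B.indicator 1 (Function.update x i v) = (0 : ENNReal)) ↔
      ∀ᵐ x : Fin m → ℝ, x ∈ A → ∀ᵐ v : ℝ, cond E x i v → Function.update x i v ∉ B := by
    intro A B hA hB
    have hm : Measurable (fun p : (Fin m → ℝ) × ℝ =>
        (A.indicator 1 p.1 * B.indicator 1 (Function.update p.1 i p.2) : ENNReal)) :=
      ((measurable_one.indicator hA).comp measurable_fst).mul
        ((measurable_one.indicator hB).comp (cont_upd i).measurable)
    rw [setLIntegral_congr_fun (g := fun x => ∫⁻ v, {p : (Fin m → ℝ) × ℝ | cond E p.1 i p.2}.indicator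
      (fun p => (A.indicator 1 p.1 * B.indicator 1 (Function.update p.1 i p.2) : ENNReal)) (x, v))
        (isOpen_simU m E).measurableSet]
    · have hm2 := hm.indicator (isOpen_cond E i).measurableSet
      rw [lintegral_eq_zero_iff hm2.lintegral_prod_right', Filter.EventuallyEq,
        ae_restrict_iff' (isOpen_simU m E).measurableSet]
      refine eventually_congr (Eventually.of_forall fun x => ?_)
      simp only [Pi.zero_apply]
      rw [lintegral_eq_zero_iff (f := fun v => {p : (Fin m → ℝ) × ℝ | cond E p.1 i p.2}.indicator
      (fun p => (A.indicator 1 p.1 * B.indicator 1 (Function.update p.1 i p.2) : ENNReal)) (x, v)) (hm2.comp measurable_prodMk_left)]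
      constructor
      · intro h hxA
        by_cases hxU : x ∈ simU m E
        · filter_upwards [h hxU] with v hv hc hB
          simp [indicator, hc, hxA, hB] at hv
        · exact Eventually.of_forall fun v hc => absurd hc.1 hxU
      · intro h hxU
        by_cases hxA : x ∈ A
        · filter_upwards [h hxA] with v hv
          by_cases hc : cond E x i v
          · simp [indicator, hv hc]
          · simp [indicator, hc]
        · exact Eventually.of_forall fun v => by simp [indicator, hxA]
    · intro x hx
      simp only
      rw [← lintegral_indicator measurableSet_Ioo]
      congr 1
      ext v
      by_cases hv : v ∈ Ioo (tk E x) (tk E x + x i)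
      · have hmem : (x, v) ∈ {p : (Fin m → ℝ) × ℝ | cond E p.1 i p.2} := ⟨hx, hv⟩
        rw [indicator_of_mem hv, indicator_of_mem hmem]
      · rw [indicator_of_notMem hv]
        exact (indicator_of_notMem (M := ENNReal) (s := {p : (Fin m → ℝ) × ℝ | cond E p.1 i p.2}) (a := (x, v)) (fun h => hv h.2) _).symm
  rw [← key hB hA]
  rw [← key hA hB] at h
  rw [← h]
  have := dsymm E i (fun a b => (A.indicator 1 a * B.indicator 1 b : ENNReal)) (by
    exact ((measurable_one.indicator hA).comp measurable_fst).mul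
        ((measurable_one.indicator hB).comp measurable_snd))
  rw [this]
  simp only [mul_comm]

lemma step2 {m : ℕ} {E : ℝ} {N : Set (Fin m → ℝ)} (hN : MeasurableSet N)
    (hA : Absb E N) {x : Fin m → ℝ} {i : Fin m} {v : ℝ}
    (hc : cond E x i v) (h : Function.update x i v ∈ Wset E N) : x ∈ Wset E N := by
  obtain ⟨O, hO, hxO, hOU, h0⟩ := h
  have hpc : Continuous (fun z : Fin m → ℝ => Function.update z i v) := by fun_prop
  have hUm := (isOpen_simU m E).measurableSet
  have a1 := null_ae (E := E) i hN (hUm.diff hN) (Eventually.of_forall fun y hy => by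
    filter_upwards [hA y hy i] with v hv hc hh
    exact hh.2 (hv hc))
  have a2 := null_ae (E := E) i (A := O \ N) (B := simU m E) (hO.measurableSet.diff hN) hUm (by
    have : ∀ᵐ x : Fin m → ℝ, x ∉ O \ N := by
      exact measure_eq_zero_iff_ae_notMem.1 h0
    filter_upwards [this] with y hy hy' using absurd hy' hy)
  refine ⟨{z | cond E z i v ∧ Function.update z i v ∈ O}, ?_, ⟨hc, hxO⟩, fun z hz => hz.1.1, ?_⟩
  · exact ((isOpen_cond E i).preimage (by fun_prop : Continuous fun z : Fin m → ℝ => (z, v))).inter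
      (hO.preimage hpc)
  · suffices hs : ∀ᵐ z : Fin m → ℝ, ¬ (z ∈ {z | cond E z i v ∧ Function.update z i v ∈ O} \ N) by
      exact measure_eq_zero_iff_ae_notMem.2 hs
    filter_upwards [a1, a2] with z h1 h2 ⟨⟨hzc, hzO⟩, hzN⟩
    have h1' := h1 ⟨hzc.1, hzN⟩
    have h2' := h2 hzc.1
    have hop : IsOpen {v' : ℝ | cond E z i v' ∧ Function.update z i v' ∈ O} :=
      ((isOpen_cond E i).preimage (by fun_prop : Continuous fun v : ℝ => (z, v))).inter
      (hO.preimage (by fun_prop : Continuous fun v : ℝ => Function.update z i v))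
    have hpos := hop.measure_pos volume ⟨v, hzc, hzO⟩
    refine hpos.ne' ?_
    have : ∀ᵐ v' : ℝ, ¬ (cond E z i v' ∧ Function.update z i v' ∈ O) := by
      filter_upwards [h1', h2'] with v' g1 g2 ⟨g3, g4⟩
      by_cases hn : Function.update z i v' ∈ N
      · exact g1 g3 hn
      · exact g2 g3 ⟨g4, hn⟩
    exact measure_eq_zero_iff_ae_notMem.2 this

lemma W_iff {m : ℕ} {E : ℝ} {N : Set (Fin m → ℝ)} (hN : MeasurableSet N)
    (hA : Absb E N) {x : Fin m → ℝ} {i : Fin m} {v : ℝ}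
    (hc : cond E x i v) : Function.update x i v ∈ Wset E N ↔ x ∈ Wset E N := by
  refine ⟨step2 hN hA hc, fun h => ?_⟩
  refine step2 hN hA (cond_upd hc) ?_
  simpa using h

/-- the point with tank `e` -/
def Pp (E e : ℝ) {m : ℕ} (o : Fin m) (f : Fin m → ℝ) : Fin m → ℝ :=
  Function.update f o (tk E f + f o - e)

lemma tk_Pp (E e : ℝ) {m : ℕ} (o : Fin m) (f : Fin m → ℝ) : tk E (Pp E e o f) = e := by
  unfold Pp; rw [tk_upd]; ring

lemma Pp_upd (E e : ℝ) {m : ℕ} (o : Fin m) (f : Fin m → ℝ) (v : ℝ) :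
    Pp E e o (Function.update f o v) = Pp E e o f := by
  unfold Pp; rw [tk_upd]; simp

lemma conn1 {m : ℕ} {E : ℝ} {W : Set (Fin m → ℝ)}
    (hW : ∀ (x : Fin m → ℝ) i v, cond E x i v → (Function.update x i v ∈ W ↔ x ∈ W))
    (o : Fin m) {e : ℝ} (he : 0 < e) {f : Fin m → ℝ} (hf : f ∈ simU m E) (hfe : e < f o) :
    Pp E e o f ∈ W ↔ f ∈ W := by
  refine hW _ _ _ ⟨hf, ?_, ?_⟩ <;> linarith

lemma conn2 {m : ℕ} {E : ℝ} {W : Set (Fin m → ℝ)}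
    (hW : ∀ (x : Fin m → ℝ) i v, cond E x i v → (Function.update x i v ∈ W ↔ x ∈ W))
    (o : Fin m) {e : ℝ} (he : 0 < e) {f : Fin m → ℝ} (hf : f ∈ simU m E) (hfe : ∀ j, 2 * e ≤ f j)
    (hft : tk E f = e) (s : Finset (Fin m)) (hs : o ∉ s) :
    ∃ g : Fin m → ℝ, g ∈ simU m E ∧ (∀ j, 2 * e ≤ g j) ∧ tk E g = e ∧ (g ∈ W ↔ f ∈ W) ∧
      (∀ j ∈ s, g j = 2 * e) := by
  classical
  induction s using Finset.induction_on with
  | empty => exact ⟨f, hf, hfe, hft, Iff.rfl, by simp⟩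
  | insert k s hk ih =>
    obtain ⟨g, hg, hge, hgt, hgW, hgs⟩ := ih (fun h => hs (Finset.mem_insert_of_mem h))
    have hok : o ≠ k := fun h => hs (h ▸ Finset.mem_insert_self _ _)
    have hc : cond E g k (2 * e) := ⟨hg, by rw [hgt]; linarith, by rw [hgt]; linarith [hge k]⟩
    have hc' := cond_mem hc
    have ho : Function.update g k (2 * e) o = g o := by simp [hok]
    have htk : tk E (Function.update g k (2 * e)) = g k - e := by rw [tk_upd, hgt]; ring
    have h2 := conn1 hW o he hc' (by rw [ho]; linarith [hge o])
    have hPo : Pp E e o (Function.update g k (2 * e)) o = g k + g o - 2 * e := by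
      unfold Pp; rw [htk, ho]; simp; ring
    have hPn : ∀ j, j ≠ o → Pp E e o (Function.update g k (2 * e)) j
        = Function.update g k (2 * e) j := by
      intro j hj; unfold Pp; simp [hj]
    have hlt : ∀ j, 2 * e ≤ Pp E e o (Function.update g k (2 * e)) j := by
      intro j
      by_cases hj : j = o
      · subst hj; rw [hPo]; linarith [hge j, hge k]
      · rw [hPn j hj]
        by_cases hjk : j = k
        · subst hjk; simp
        · simpa [hjk] using hge j
    refine ⟨_, ?_, hlt, tk_Pp _ _ _ _, h2.trans ((hW _ _ _ hc).trans hgW), ?_⟩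
    · exact mem_simU.2 ⟨fun j => lt_of_lt_of_le (by linarith) (hlt j), by rw [tk_Pp]; exact he⟩
    · intro j hj
      have hjo : j ≠ o := fun h => hs (h ▸ hj)
      rw [hPn j hjo]
      by_cases hjk : j = k
      · subst hjk; simp
      · rcases Finset.mem_insert.1 hj with h | h
        · exact absurd h hjk
        · simpa [hjk] using hgs j h

lemma conn3 {m : ℕ} {E : ℝ} {W : Set (Fin m → ℝ)}
    (hW : ∀ (x : Fin m → ℝ) i v, cond E x i v → (Function.update x i v ∈ W ↔ x ∈ W))
    (o : Fin m) {e : ℝ} (he : 0 < e) {f : Fin m → ℝ} (hf : f ∈ simU m E) (hfe : ∀ j, 3 * e < f j) :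
    (Pp E e o (fun _ => 2 * e) ∈ W ↔ f ∈ W) := by
  classical
  have hlt : ∀ j, 2 * e ≤ Pp E e o f j := by
    intro j
    by_cases hj : j = o
    · subst hj; unfold Pp; simp; linarith [hfe j, (mem_simU.1 hf).2]
    · unfold Pp; simp [hj]; linarith [hfe j]
  have hU : Pp E e o f ∈ simU m E :=
    mem_simU.2 ⟨fun j => lt_of_lt_of_le (by linarith) (hlt j), by rw [tk_Pp]; exact he⟩
  obtain ⟨g, hg, hge, hgt, hgW, hgs⟩ := conn2 hW o he hU hlt (tk_Pp _ _ _ _)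
    (Finset.univ.erase o) (by simp)
  rw [← conn1 hW o he hf (by linarith [hfe o]), ← hgW]
  have : g = Pp E e o (fun _ => 2 * e) := by
    have h1 : Pp E e o g = g := by unfold Pp; rw [hgt]; simp
    rw [← h1, ← Pp_upd E e o g (2 * e)]
    congr 1
    ext j
    by_cases hj : j = o
    · subst hj; simp
    · simpa [hj] using hgs j (by simp [hj])
  rw [this]

lemma irred {m : ℕ} (hm : 1 ≤ m) {E : ℝ} {N : Set (Fin m → ℝ)} (hN : MeasurableSet N)
    (hNU : N ⊆ simU m E) (hA : Absb E N) {x : Fin m → ℝ} (hx : x ∈ N) :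
    volume (simU m E \ N) = 0 := by
  have hW := fun x i v => W_iff hN hA (x := x) (i := i) (v := v)
  obtain ⟨p, hp⟩ := W_nonempty hN hNU hA hx
  have hpU : p ∈ simU m E := by obtain ⟨O, _, h1, h2, _⟩ := hp; exact h2 h1
  let o : Fin m := ⟨0, hm⟩
  have : Nonempty (Fin m) := ⟨o⟩
  have all : simU m E ⊆ Wset E N := by
    intro q hq
    obtain ⟨j1, h1⟩ := Finite.exists_min p
    obtain ⟨j2, h2⟩ := Finite.exists_min q
    have hp1 := hpU.1 j1
    have hq1 := hq.1 j2
    obtain ⟨e3, he3, he'⟩ := exists_between (lt_min hp1 hq1)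
    obtain ⟨e, rfl⟩ : ∃ e, e3 = 3 * e := ⟨e3 / 3, by ring⟩
    have he : 0 < e := by linarith
    rw [lt_min_iff] at he'
    rw [← conn3 hW o he hq (fun j => he'.2.trans_le (h2 j)),
      conn3 hW o he hpU (fun j => he'.1.trans_le (h1 j))]
    exact hp
  refine measure_null_of_locally_null _ fun q hq => ?_
  obtain ⟨O, hO, hqO, hOU, h0⟩ := all hq.1
  refine ⟨(simU m E \ N) ∩ O, inter_mem_nhdsWithin _ (hO.mem_nhds hqO), ?_⟩
  have hsub : (simU m E \ N) ∩ O ⊆ O \ N := fun z hz => ⟨hz.2, hz.1.2⟩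
  exact measure_mono_null hsub h0

end EEx
end

noncomputable section
namespace EEx

def rho (E : ℝ) {m : ℕ} (x : Fin m → ℝ) : ENNReal := ENNReal.ofReal ((tk E x) ^ (-(1/2) : ℝ))

lemma meas_rho (E : ℝ) {m : ℕ} : Measurable (fun x : Fin m → ℝ => rho E x) := by
  unfold rho
  exact ((meas_tk E).pow_const _).ennreal_ofReal

lemma img (y a : ℝ) (ha : 0 < a) : (fun u : ℝ => y + (1 - u ^ 2) * a) '' Ioo 0 1 = Ioo y (y + a) := by
  ext v
  constructor
  · rintro ⟨u, ⟨h0, h1⟩, rfl⟩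
    have h2 : u ^ 2 < 1 := by nlinarith
    have h3 : 0 < u ^ 2 := by positivity
    constructor <;> simp only <;> nlinarith
  · rintro ⟨h0, h1⟩
    refine ⟨Real.sqrt ((y + a - v) / a), ⟨Real.sqrt_pos.2 (div_pos (by linarith) ha), ?_⟩, ?_⟩
    · rw [Real.sqrt_lt' one_pos, div_lt_iff₀ ha]; linarith
    · simp only
      rw [Real.sq_sqrt (div_pos (by linarith) ha).le]
      field_simp
      ring

lemma J_lint {m : ℕ} {E : ℝ} {x : Fin m → ℝ} (hx : x ∈ simU m E) (i : Fin m)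
    (F : (Fin m → ℝ) → ENNReal) :
    ENNReal.ofReal (Real.sqrt (x i)) * ∫⁻ u in Ioo (0:ℝ) 1, F (T0 m E i u x)
    = ∫⁻ v in Ioo (tk E x) (tk E x + x i),
        rho E (Function.update x i v) / 2 * F (Function.update x i v) := by
  have ha := hx.1 i
  have hd : ∀ u ∈ Ioo (0:ℝ) 1, HasDerivWithinAt (fun u : ℝ => tk E x + (1 - u ^ 2) * x i)
      (- (2 * u) * x i) (Ioo 0 1) u := by
    intro u _
    apply HasDerivAt.hasDerivWithinAt
    have := (((hasDerivAt_pow 2 u).const_sub 1).mul_const (x i)).const_add (tk E x)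
    simpa using this
  have hinj : InjOn (fun u : ℝ => tk E x + (1 - u ^ 2) * x i) (Ioo 0 1) := by
    intro u hu w hw h
    simp only at h
    have h1 : u ^ 2 * x i = w ^ 2 * x i := by linarith
    have h2 : u ^ 2 = w ^ 2 := mul_right_cancel₀ ha.ne' h1
    exact (pow_left_inj₀ hu.1.le hw.1.le two_ne_zero).1 h2
  rw [← img (tk E x) (x i) ha, lintegral_image_eq_lintegral_abs_deriv_mul measurableSet_Ioo hd hinj,
    ← lintegral_const_mul' _ _ ENNReal.ofReal_ne_top]
  refine setLIntegral_congr_fun measurableSet_Ioo fun u hu => ?_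
  have hT : T0 m E i u x = Function.update x i (tk E x + (1 - u ^ 2) * x i) := rfl
  rw [← hT, ← mul_assoc]
  congr 1
  have htk : tk E (T0 m E i u x) = u ^ 2 * x i := by rw [hT, tk_upd]; ring
  unfold rho
  rw [htk, show (2 : ENNReal) = ENNReal.ofReal 2 by simp, ← ENNReal.ofReal_div_of_pos two_pos,
    ← ENNReal.ofReal_mul (abs_nonneg _)]
  congr 1
  have hs := Real.sqrt_pos.2 ha
  have hu0 := hu.1
  rw [Real.rpow_neg (by positivity), ← Real.sqrt_eq_rpow, Real.sqrt_mul (by positivity),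
    Real.sqrt_sq hu0.le, abs_mul, abs_neg, abs_of_pos ha, abs_of_pos (by positivity : 0 < 2 * u)]
  field_simp
  rw [Real.sq_sqrt ha.le]

lemma meas_T : ∀ {m : ℕ} {E : ℝ} (i : Fin m),
    Measurable (fun p : Delta m E × ℝ => Texch m E i p.2 p.1) := by
  intro m E i
  have hU := (isOpen_simU m E).measurableSet
  rw [← (MeasurableEmbedding.subtype_coe hU).measurable_comp_iff]
  have : (Subtype.val ∘ fun p : Delta m E × ℝ => Texch m E i p.2 p.1)
      = fun p : Delta m E × ℝ => if p.2 ∈ Ioo (0:ℝ) 1 then T0 m E i p.2 p.1.1 else p.1.1 := by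
    ext p : 1
    by_cases h : p.2 ∈ Ioo (0:ℝ) 1
    · simp only [Function.comp, Texch, dif_pos h, if_pos h]
    · simp only [Function.comp, Texch, dif_neg h, if_neg h]
  rw [this]
  refine Measurable.ite (measurable_snd measurableSet_Ioo) ?_ (measurable_subtype_coe.comp measurable_fst)
  have hx : Measurable (fun p : Delta m E × ℝ => p.1.1) := measurable_subtype_coe.comp measurable_fst
  have hxi : Measurable (fun p : Delta m E × ℝ => p.1.1 i) := (measurable_pi_apply i).comp hx
  have hv : Measurable (fun p : Delta m E × ℝ => tk E p.1.1 + (1 - p.2 ^ 2) * p.1.1 i) :=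
    ((meas_tk E).comp hx).add (((measurable_const.sub (measurable_snd.pow_const 2))).mul hxi)
  exact (cont_upd i).measurable.comp (hx.prodMk hv)

def Jm {m : ℕ} {E : ℝ} (i : Fin m) (x : Delta m E) : Measure (Delta m E) :=
  ENNReal.ofReal (Real.sqrt (x.1 i)) • Measure.map (fun u => Texch m E i u x) unif01

instance : IsProbabilityMeasure unif01 := ⟨by simp [unif01]⟩

lemma Jm_apply' {m : ℕ} {E : ℝ} (i : Fin m) (x : Delta m E) {B : Set (Delta m E)}
    (hB : MeasurableSet B) :
    Jm i x B = ENNReal.ofReal (Real.sqrt (x.1 i)) *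
      unif01 (Prod.mk x ⁻¹' ((fun p : Delta m E × ℝ => Texch m E i p.2 p.1) ⁻¹' B)) := by
  unfold Jm
  rw [Measure.smul_apply, Measure.map_apply (f := fun u => Texch m E i u x) ((meas_T i).comp measurable_prodMk_left) hB]
  rfl

lemma meas_Jm {m : ℕ} {E : ℝ} (i : Fin m) : Measurable (Jm i : Delta m E → Measure (Delta m E)) := by
  refine Measure.measurable_of_measurable_coe _ fun B hB => ?_
  simp_rw [Jm_apply' i _ hB]
  refine Measurable.mul ?_ (measurable_measure_prodMk_left (meas_T i hB))
  exact (((measurable_pi_apply i).comp measurable_subtype_coe).sqrt).ennreal_ofReal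

lemma Jm_apply {m : ℕ} {E : ℝ} (i : Fin m) (x : Delta m E) {B : Set (Fin m → ℝ)}
    (hB : MeasurableSet B) :
    Jm i x (Subtype.val ⁻¹' B) = ∫⁻ v in Ioo (tk E x.1) (tk E x.1 + x.1 i),
        rho E (Function.update x.1 i v) / 2 * B.indicator 1 (Function.update x.1 i v) := by
  rw [← J_lint x.2 i, Jm_apply' i x (measurable_subtype_coe hB)]
  congr 1
  unfold unif01
  have hm : MeasurableSet (Prod.mk x ⁻¹' ((fun p : Delta m E × ℝ => Texch m E i p.2 p.1) ⁻¹'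
      (Subtype.val ⁻¹' B))) := measurable_prodMk_left (meas_T i (measurable_subtype_coe hB))
  rw [← lintegral_indicator_one hm]
  refine setLIntegral_congr_fun measurableSet_Ioo fun u hu => ?_
  have : (Texch m E i u x).1 = T0 m E i u x.1 := by simp only [Texch, dif_pos hu]
  have h2 : u ∈ Prod.mk x ⁻¹' ((fun p : Delta m E × ℝ => Texch m E i p.2 p.1) ⁻¹'
      (Subtype.val ⁻¹' B)) ↔ T0 m E i u x.1 ∈ B := by rw [← this]; rfl
  by_cases h : T0 m E i u x.1 ∈ B
  · rw [indicator_of_mem h, indicator_of_mem (h2.2 h)]; rfl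
  · rw [indicator_of_notMem h, indicator_of_notMem (fun h' => h (h2.1 h'))]

lemma Jm_univ {m : ℕ} {E : ℝ} (i : Fin m) (x : Delta m E) :
    Jm i x univ = ENNReal.ofReal (Real.sqrt (x.1 i)) := by
  rw [Jm_apply' i x MeasurableSet.univ]; simp

lemma J_one {m : ℕ} {E : ℝ} {x : Fin m → ℝ} (hx : x ∈ simU m E) (i : Fin m) :
    ∫⁻ v in Ioo (tk E x) (tk E x + x i), rho E (Function.update x i v) / 2 =
    ENNReal.ofReal (Real.sqrt (x i)) := by
  have := J_lint hx i (fun _ => 1)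
  simpa using this.symm

lemma lint_piPre {m : ℕ} {E : ℝ} (F : (Fin m → ℝ) → ENNReal) (hF : Measurable F) :
    ∫⁻ x : Delta m E, F x.1 ∂(piPre m E) = ∫⁻ x in simU m E, rho E x * F x := by
  unfold piPre
  rw [lintegral_withDensity_eq_lintegral_mul]
  · exact lintegral_subtype_comap (isOpen_simU m E).measurableSet (fun x => rho E x * F x)
  · exact (meas_rho E).comp measurable_subtype_coe
  · exact hF.comp measurable_subtype_coe

lemma J_inv {m : ℕ} {E : ℝ} (i : Fin m) {A : Set (Delta m E)} (hA : MeasurableSet A) :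
    ∫⁻ x, Jm i x A ∂(piPre m E) = ∫⁻ x in A, ENNReal.ofReal (Real.sqrt (x.1 i)) ∂(piPre m E) := by
  obtain ⟨A', hA', rfl⟩ := hA
  have hu := (cont_upd i (m := m)).measurable
  have hρ := meas_rho E (m := m)
  have hI : Measurable (A'.indicator 1 : (Fin m → ℝ) → ENNReal) := measurable_one.indicator hA'
  rw [← lintegral_indicator (measurable_subtype_coe hA')]
  simp_rw [Jm_apply i _ hA']
  have hG : Measurable (fun p : (Fin m → ℝ) × ℝ => {p : (Fin m → ℝ) × ℝ | cond E p.1 i p.2}.indicator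
      (fun p => rho E (Function.update p.1 i p.2) / 2 * A'.indicator 1 (Function.update p.1 i p.2)) p) := by
    refine Measurable.indicator ?_ (isOpen_cond E i).measurableSet
    exact ((hρ.comp hu).div_const 2).mul (hI.comp hu)
  have e1 : ∫⁻ x : Delta m E, ∫⁻ v : ℝ in Ioo (tk E x.1) (tk E x.1 + x.1 i),
        rho E (Function.update x.1 i v) / 2 * A'.indicator 1 (Function.update x.1 i v) ∂volume ∂(piPre m E)
      = ∫⁻ x in simU m E, ∫⁻ v in Ioo (tk E x) (tk E x + x i),
        rho E x * (rho E (Function.update x i v) / 2 * A'.indicator 1 (Function.update x i v)) := by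
    have e0 : ∀ x ∈ simU m E, ∫⁻ v in Ioo (tk E x) (tk E x + x i),
        rho E (Function.update x i v) / 2 * A'.indicator 1 (Function.update x i v)
        = ∫⁻ v, {p : (Fin m → ℝ) × ℝ | cond E p.1 i p.2}.indicator
      (fun p => rho E (Function.update p.1 i p.2) / 2 * A'.indicator 1 (Function.update p.1 i p.2)) (x, v) := by
      intro x hx
      rw [← lintegral_indicator measurableSet_Ioo]
      congr 1
      ext v
      by_cases hv : v ∈ Ioo (tk E x) (tk E x + x i)
      · have hmem : (x, v) ∈ {p : (Fin m → ℝ) × ℝ | cond E p.1 i p.2} := ⟨hx, hv⟩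
        rw [indicator_of_mem hv, indicator_of_mem hmem]
      · have hmem : (x, v) ∉ {p : (Fin m → ℝ) × ℝ | cond E p.1 i p.2} := fun h => hv h.2
        rw [indicator_of_notMem hv, indicator_of_notMem hmem]
    rw [lintegral_congr fun x : Delta m E => e0 x.1 x.2, lint_piPre _ hG.lintegral_prod_right']
    refine setLIntegral_congr_fun (isOpen_simU m E).measurableSet fun x hx => ?_
    rw [← e0 x hx, lintegral_const_mul' (rho E x) _ ENNReal.ofReal_ne_top]
  rw [e1, dsymm E i (fun a b => rho E a * (rho E b / 2 * A'.indicator 1 b))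
    ((hρ.comp measurable_fst).mul (((hρ.comp measurable_snd).div_const 2).mul (hI.comp measurable_snd)))]
  have e2 : ∀ x : Delta m E, (Subtype.val ⁻¹' A').indicator
      (fun x : Delta m E => ENNReal.ofReal (Real.sqrt (x.1 i))) x
      = A'.indicator (fun x => ENNReal.ofReal (Real.sqrt (x i))) x.1 := fun x => rfl
  rw [lintegral_congr e2, lint_piPre]
  · refine setLIntegral_congr_fun (isOpen_simU m E).measurableSet fun x hx => ?_
    by_cases hxA : x ∈ A'
    · simp only [indicator_of_mem hxA, Pi.one_apply, mul_one]
      rw [← J_one hx i, ← lintegral_const_mul' (rho E x) _ ENNReal.ofReal_ne_top]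
      congr 1
      ext v
      simp only [div_eq_mul_inv]
      ring
    · simp [hxA]
  · exact ((measurable_pi_apply i).sqrt.ennreal_ofReal).indicator hA'

lemma Z_fin (m : ℕ) (E : ℝ) (hE : 0 < E) : piPre m E univ ≠ ⊤ := by
  have hU := (isOpen_simU m E).measurableSet
  have hρ := meas_rho E (m := m)
  have hle : ∀ x ∈ simU m E, ∀ i, x i ≤ E := fun x hx i =>
    (Finset.single_le_sum (fun j _ => (hx.1 j).le) (Finset.mem_univ i)).trans hx.2.le
  have hvol : volume (simU m E) ≠ ⊤ := by
    have hsub : simU m E ⊆ Icc 0 (fun _ => E) := fun x hx => ⟨fun i => (hx.1 i).le, hle x hx⟩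
    exact ((measure_mono hsub).trans_lt isCompact_Icc.measure_lt_top).ne
  have h1 : ∀ i : Fin m, ∫⁻ x in simU m E, rho E x / 2 * ENNReal.ofReal (x i) ≠ ⊤ := by
    intro i
    have := dsymm E i (fun _ b => rho E b / 2) ((hρ.comp measurable_snd).div_const 2)
    simp only [lintegral_const, Measure.restrict_apply_univ, Real.volume_Ioo,
      add_sub_cancel_left] at this
    rw [← this]
    refine ne_top_of_le_ne_top (ENNReal.mul_ne_top (ENNReal.ofReal_ne_top (r := Real.sqrt E)) hvol) ?_
    rw [← setLIntegral_const]
    refine setLIntegral_mono' hU fun x hx => ?_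
    rw [J_one hx i]
    exact ENNReal.ofReal_le_ofReal (Real.sqrt_le_sqrt (hle x hx i))
  have h2 : ∫⁻ x in simU m E, ENNReal.ofReal (Real.sqrt (tk E x)) ≠ ⊤ := by
    refine ne_top_of_le_ne_top (ENNReal.mul_ne_top (ENNReal.ofReal_ne_top (r := Real.sqrt E)) hvol) ?_
    rw [← setLIntegral_const]
    refine setLIntegral_mono' hU fun x hx => ENNReal.ofReal_le_ofReal (Real.sqrt_le_sqrt ?_)
    have : 0 ≤ ∑ j, x j := Finset.sum_nonneg fun j _ => (hx.1 j).le
    unfold tk; linarith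
  have h3 : ∫⁻ x in simU m E, rho E x * ENNReal.ofReal E ≠ ⊤ := by
    have : ∀ x ∈ simU m E, rho E x * ENNReal.ofReal E
        = 2 * (∑ i, rho E x / 2 * ENNReal.ofReal (x i)) + ENNReal.ofReal (Real.sqrt (tk E x)) := by
      intro x hx
      have ht := (mem_simU.1 hx).2
      rw [← Finset.mul_sum, ← mul_assoc, ENNReal.mul_div_cancel (by simp) (by simp),
        ← ENNReal.ofReal_sum_of_nonneg fun j _ => (hx.1 j).le]
      have hE' : E = ∑ j, x j + tk E x := by unfold tk; ring
      conv_lhs => rw [hE']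
      rw [ENNReal.ofReal_add (Finset.sum_nonneg fun j _ => (hx.1 j).le) ht.le, mul_add]
      rw [← hE']
      congr 1
      unfold rho
      rw [← ENNReal.ofReal_mul (by positivity)]
      congr 1
      rw [Real.rpow_neg ht.le, ← Real.sqrt_eq_rpow]
      have hs := Real.sqrt_pos.2 ht
      field_simp
      rw [Real.sq_sqrt ht.le]
    rw [setLIntegral_congr_fun hU this, lintegral_add_right _ ((meas_tk E).sqrt.ennreal_ofReal),
      lintegral_const_mul' _ _ (by simp), lintegral_finsetSum (f := fun i x => rho E x / 2 * ENNReal.ofReal (x i)) _ fun i _ =>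
        (hρ.div_const 2).mul (measurable_pi_apply i).ennreal_ofReal]
    refine ENNReal.add_ne_top.2 ⟨ENNReal.mul_ne_top (by simp) ?_, h2⟩
    exact ENNReal.sum_ne_top.2 fun i _ => h1 i
  have h4 : piPre m E univ = ∫⁻ x in simU m E, rho E x := by
    have := lint_piPre (m := m) (E := E) (fun _ => 1) measurable_const
    simpa using this
  rw [lintegral_mul_const _ hρ, ← h4] at h3
  intro h
  rw [h] at h3
  exact h3 (ENNReal.top_mul (by simpa using hE))

lemma piPre_null {m : ℕ} {E : ℝ} {B : Set (Fin m → ℝ)} (hB : MeasurableSet B) :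
    piPre m E (Subtype.val ⁻¹' B) = 0 ↔ volume (simU m E ∩ B) = 0 := by
  have hU := (isOpen_simU m E).measurableSet
  have hI : Measurable (B.indicator 1 : (Fin m → ℝ) → ENNReal) := measurable_one.indicator hB
  have h := lint_piPre (m := m) (E := E) (B.indicator 1) hI
  have e : ∫⁻ x : Delta m E, B.indicator 1 x.1 ∂(piPre m E) = piPre m E (Subtype.val ⁻¹' B) := by
    rw [← lintegral_indicator_one (measurable_subtype_coe hB)]
    rfl
  rw [← e, h, lintegral_eq_zero_iff (f := fun x => rho E x * B.indicator 1 x) ((meas_rho E).mul hI), Filter.EventuallyEq,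
    ae_restrict_iff' hU, measure_eq_zero_iff_ae_notMem]
  refine eventually_congr (Eventually.of_forall fun x => ?_)
  constructor
  · rintro h ⟨hx, hxB⟩
    have := h hx
    have ht := (mem_simU.1 hx).2
    simp [hxB, rho] at this
    exact absurd this (not_le.2 (Real.rpow_pos_of_pos ht _))
  · intro h hx
    have : x ∉ B := fun hb => h ⟨hx, hb⟩
    simp [this]

lemma Z_pos (m : ℕ) (E : ℝ) (hE : 0 < E) : piPre m E univ ≠ 0 := by
  intro h
  have h1 := (piPre_null (m := m) (E := E) MeasurableSet.univ).1 (by simpa using h)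
  rw [inter_univ] at h1
  refine ((isOpen_simU m E).measure_pos volume ⟨fun _ => E / (m + 1), ?_⟩).ne' h1
  refine ⟨fun i => by positivity, ?_⟩
  simp only [Finset.sum_const, Finset.card_univ, Fintype.card_fin, nsmul_eq_mul]
  rw [mul_div_assoc', div_lt_iff₀ (by positivity)]
  nlinarith

end EEx
end

noncomputable section
namespace EEx

lemma ustep_apply {m : ℕ} {E : ℝ} (x : Delta m E) {A : Set (Delta m E)} (hA : MeasurableSet A) :
    ustep m E x A = ENNReal.ofReal (1 - jumpRate m E x / Lam m E) * A.indicator 1 x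
      + (ENNReal.ofReal (Lam m E))⁻¹ * ∑ i, Jm i x A := by
  unfold ustep
  rw [Measure.add_apply, Measure.smul_apply, Measure.smul_apply, Measure.dirac_apply' _ hA,
    Measure.sum_apply _ hA, tsum_fintype]
  rfl

lemma meas_jr {m : ℕ} {E : ℝ} : Measurable (jumpRate m E) := by
  unfold jumpRate
  exact Finset.measurable_sum _ fun i _ => ((measurable_pi_apply i).comp measurable_subtype_coe).sqrt

lemma meas_c {m : ℕ} {E : ℝ} :
    Measurable (fun x : Delta m E => ENNReal.ofReal (1 - jumpRate m E x / Lam m E)) :=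
  (measurable_const.sub (meas_jr.div_const _)).ennreal_ofReal

lemma meas_ustep (m : ℕ) (E : ℝ) : Measurable (ustep m E) := by
  refine Measure.measurable_of_measurable_coe _ fun A hA => ?_
  simp_rw [ustep_apply _ hA]
  refine (meas_c.mul (measurable_one.indicator hA)).add (Measurable.const_mul ?_ _)
  exact Finset.measurable_sum _ fun i _ => (Measure.measurable_coe hA).comp (meas_Jm i)

lemma Lam_pos {m : ℕ} (hm : 1 ≤ m) {E : ℝ} (hE : 0 < E) : 0 < Lam m E := by
  unfold Lam
  have : (0:ℝ) < m := by exact_mod_cast hm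
  positivity

lemma jr_le {m : ℕ} {E : ℝ} (x : Delta m E) : jumpRate m E x ≤ Lam m E := by
  unfold jumpRate Lam
  apply Real.le_sqrt_of_sq_le
  have h := sq_sum_le_card_mul_sum_sq (s := Finset.univ) (f := fun i => Real.sqrt (x.1 i))
  refine h.trans ?_
  simp only [Finset.card_univ, Fintype.card_fin]
  refine mul_le_mul_of_nonneg_left ?_ (Nat.cast_nonneg m)
  rw [Finset.sum_congr rfl fun i _ => Real.sq_sqrt (x.2.1 i).le]
  exact x.2.2.le

/-- the weights sum to one -/
lemma wt {m : ℕ} (hm : 1 ≤ m) {E : ℝ} (hE : 0 < E) (x : Delta m E) :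
    ENNReal.ofReal (1 - jumpRate m E x / Lam m E)
      + (ENNReal.ofReal (Lam m E))⁻¹ * ∑ i, ENNReal.ofReal (Real.sqrt (x.1 i)) = 1 := by
  have hL := Lam_pos hm hE
  have hj : 0 ≤ jumpRate m E x := Finset.sum_nonneg fun i _ => Real.sqrt_nonneg _
  rw [← ENNReal.ofReal_sum_of_nonneg fun i _ => Real.sqrt_nonneg _,
    ← ENNReal.ofReal_inv_of_pos hL, ← ENNReal.ofReal_mul (by positivity)]
  change _ + ENNReal.ofReal (_ * jumpRate m E x) = 1
  rw [← ENNReal.ofReal_add]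
  · rw [← ENNReal.ofReal_one]
    congr 1
    ring
  · rw [sub_nonneg, div_le_one hL]; exact jr_le x
  · positivity

lemma ustep_univ {m : ℕ} (hm : 1 ≤ m) {E : ℝ} (hE : 0 < E) (x : Delta m E) :
    ustep m E x univ = 1 := by
  rw [ustep_apply _ MeasurableSet.univ, ← wt hm hE x]
  simp [Jm_univ]

lemma inv_ustep {m : ℕ} (hm : 1 ≤ m) {E : ℝ} (hE : 0 < E) :
    (piPre m E).bind (ustep m E) = piPre m E := by
  ext A hA
  rw [Measure.bind_apply hA (meas_ustep m E).aemeasurable]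
  simp_rw [ustep_apply _ hA]
  have hs : ∀ i : Fin m, Measurable (fun x : Delta m E => ENNReal.ofReal (Real.sqrt (x.1 i))) :=
    fun i => ((measurable_pi_apply i).comp measurable_subtype_coe).sqrt.ennreal_ofReal
  have hcA : Measurable (fun x : Delta m E =>
      ENNReal.ofReal (1 - jumpRate m E x / Lam m E) * A.indicator 1 x) :=
    meas_c.mul (measurable_one.indicator hA)
  have hJ : ∀ i : Fin m, Measurable (fun x : Delta m E => Jm i x A) :=
    fun i => (Measure.measurable_coe hA).comp (meas_Jm i)
  rw [lintegral_add_left hcA, lintegral_const_mul _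
    (Finset.measurable_sum _ fun i _ => hJ i),
    lintegral_finsetSum _ fun i _ => hJ i]
  simp_rw [J_inv _ hA]
  rw [← lintegral_finsetSum _ fun i _ => hs i, ← lintegral_const_mul _
    (Finset.measurable_sum _ fun i _ => hs i)]
  have e : ∫⁻ x : Delta m E, ENNReal.ofReal (1 - jumpRate m E x / Lam m E) * A.indicator 1 x ∂(piPre m E)
      = ∫⁻ x in A, ENNReal.ofReal (1 - jumpRate m E x / Lam m E) ∂(piPre m E) := by
    rw [← lintegral_indicator hA]
    congr 1
    ext x
    by_cases h : x ∈ A <;> simp [h]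
  rw [e, ← lintegral_add_left meas_c, lintegral_congr fun x => wt hm hE x]
  simp

lemma meas_iter (m : ℕ) (E : ℝ) (n : ℕ) : Measurable (ustepIter m E n) := by
  induction n with
  | zero => exact Measure.measurable_dirac
  | succ n ih => exact (Measure.measurable_bind' ih).comp (meas_ustep m E)

lemma iter_univ {m : ℕ} (hm : 1 ≤ m) {E : ℝ} (hE : 0 < E) (n : ℕ) (x : Delta m E) :
    ustepIter m E n x univ = 1 := by
  induction n generalizing x with
  | zero => simp [ustepIter]
  | succ n ih =>
    simp only [ustepIter]
    rw [Measure.bind_apply MeasurableSet.univ (meas_iter m E n).aemeasurable]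
    simp [ih, ustep_univ hm hE]

lemma inv_iter {m : ℕ} (hm : 1 ≤ m) {E : ℝ} (hE : 0 < E) (n : ℕ) :
    (piPre m E).bind (ustepIter m E n) = piPre m E := by
  induction n with
  | zero => exact Measure.bind_dirac
  | succ n ih =>
    change (piPre m E).bind (fun x => (ustep m E x).bind (ustepIter m E n)) = _
    rw [← Measure.bind_bind (meas_ustep m E).aemeasurable (meas_iter m E n).aemeasurable,
      inv_ustep hm hE, ih]

lemma Pt_apply {m : ℕ} {E t : ℝ} (x : Delta m E) {A : Set (Delta m E)} (hA : MeasurableSet A) :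
    Pt m E t x A = ∑' n : ℕ, ENNReal.ofReal (Real.exp (-(Lam m E) * t) * ((Lam m E) * t) ^ n / n.factorial) *
      ustepIter m E n x A := by
  unfold Pt
  rw [Measure.sum_apply _ hA]
  rfl

lemma meas_Pt (m : ℕ) (E t : ℝ) : Measurable (Pt m E t) := by
  refine Measure.measurable_of_measurable_coe _ fun A hA => ?_
  simp_rw [Pt_apply _ hA]
  exact Measurable.tsum fun n =>
    ((Measure.measurable_coe hA).comp (meas_iter m E n)).const_mul _

lemma wsum {m : ℕ} {E : ℝ} : ∑' n : ℕ, ENNReal.ofReal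
    (Real.exp (-(Lam m E) * 1) * ((Lam m E) * 1) ^ n / n.factorial) = 1 := by
  have hL : 0 ≤ Lam m E := Real.sqrt_nonneg _
  have h := (NormedSpace.expSeries_div_hasSum_exp (𝔸 := ℝ) (Lam m E)).mul_left (Real.exp (-(Lam m E)))
  rw [← congrFun Real.exp_eq_exp_ℝ, ← Real.exp_add, neg_add_cancel, Real.exp_zero] at h
  rw [← ENNReal.ofReal_tsum_of_nonneg]
  · have e := h.tsum_eq
    simp only [mul_one, mul_div_assoc]
    rw [e, ENNReal.ofReal_one]
  · intro n; positivity
  · simpa [mul_div_assoc] using h.summable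

lemma Pt_univ {m : ℕ} (hm : 1 ≤ m) {E : ℝ} (hE : 0 < E) (x : Delta m E) :
    Pt m E 1 x univ = 1 := by
  rw [Pt_apply _ MeasurableSet.univ]
  simp_rw [iter_univ hm hE, mul_one]
  simpa using wsum (m := m) (E := E)

lemma inv_Pt {m : ℕ} (hm : 1 ≤ m) {E : ℝ} (hE : 0 < E) :
    (piPre m E).bind (Pt m E 1) = piPre m E := by
  ext A hA
  rw [Measure.bind_apply hA (meas_Pt m E 1).aemeasurable]
  simp_rw [Pt_apply _ hA]
  have hM : ∀ n, Measurable (fun x => ustepIter m E n x A) :=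
    fun n => (Measure.measurable_coe hA).comp (meas_iter m E n)
  rw [lintegral_tsum fun n => ((hM n).const_mul _).aemeasurable]
  have : ∀ n, ∫⁻ x, ENNReal.ofReal (Real.exp (-(Lam m E) * 1) * ((Lam m E) * 1) ^ n / n.factorial) *
      ustepIter m E n x A ∂(piPre m E)
      = ENNReal.ofReal (Real.exp (-(Lam m E) * 1) * ((Lam m E) * 1) ^ n / n.factorial) * piPre m E A := by
    intro n
    rw [lintegral_const_mul _ (hM n), ← Measure.bind_apply hA (meas_iter m E n).aemeasurable,
      inv_iter hm hE]
  simp_rw [this]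
  rw [ENNReal.tsum_mul_right, wsum, one_mul]

lemma Pt_pos {m : ℕ} (hm : 1 ≤ m) {E : ℝ} (hE : 0 < E) (x : Delta m E) {A : Set (Delta m E)}
    (hA : MeasurableSet A) (h : Pt m E 1 x A = 0) : piPre m E A = 0 := by
  have hL := Lam_pos hm hE
  have hiter : ∀ n, ustepIter m E n x A = 0 := by
    intro n
    rw [Pt_apply _ hA, ENNReal.tsum_eq_zero] at h
    have := h n
    rw [mul_eq_zero, ENNReal.ofReal_eq_zero] at this
    refine this.resolve_left (not_le.2 ?_)
    positivity
  have hM : ∀ n, Measurable (fun x => ustepIter m E n x A) :=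
    fun n => (Measure.measurable_coe hA).comp (meas_iter m E n)
  set N : Set (Delta m E) := ⋂ n, {z | ustepIter m E n z A = 0} with hNdef
  have hNm : MeasurableSet N := MeasurableSet.iInter fun n => hM n (measurableSet_singleton 0)
  have hU := (isOpen_simU m E).measurableSet
  have hN' : MeasurableSet (Subtype.val '' N : Set (Fin m → ℝ)) := hU.subtype_image hNm
  have hpre : Subtype.val ⁻¹' (Subtype.val '' N : Set (Fin m → ℝ)) = N :=
    preimage_image_eq _ Subtype.val_injective
  have hNstep : ∀ z ∈ N, ustep m E z Nᶜ = 0 := by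
    intro z hz
    have : ∀ n, ∀ᵐ w ∂(ustep m E z), ustepIter m E n w A = 0 := by
      intro n
      have h1 : ustepIter m E (n+1) z A = 0 := mem_iInter.1 hz (n+1)
      simp only [ustepIter] at h1
      rw [Measure.bind_apply hA (meas_iter m E n).aemeasurable, lintegral_eq_zero_iff (hM n)] at h1
      exact h1
    have h2 := ae_all_iff.2 this
    refine measure_eq_zero_iff_ae_notMem.2 ?_
    filter_upwards [h2] with w hw hw'
    exact hw' (mem_iInter.2 hw)
  have hAbs : Absb E (Subtype.val '' N : Set (Fin m → ℝ)) := by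
    rintro _ ⟨z, hz, rfl⟩ i
    have h1 := hNstep z hz
    rw [ustep_apply _ hNm.compl, add_eq_zero, mul_eq_zero (a := (ENNReal.ofReal (Lam m E))⁻¹),
      Finset.sum_eq_zero_iff] at h1
    have h2 := (h1.2.resolve_left (by simp)) i (Finset.mem_univ i)
    rw [← hpre, ← preimage_compl, Jm_apply i z hN'.compl, lintegral_eq_zero_iff, Filter.EventuallyEq,
      ae_restrict_iff' measurableSet_Ioo] at h2
    · filter_upwards [h2] with v hv hc
      by_contra hn
      have h3 := hv hc.2
      have ht := (mem_simU.1 (cond_mem hc)).2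
      rw [indicator_of_mem hn] at h3
      simp [rho] at h3
      exact absurd h3 (not_le.2 (Real.rpow_pos_of_pos ht _))
    · have hu : Measurable fun v => Function.update z.1 i v :=
        (cont_upd i).measurable.comp measurable_prodMk_left
      exact (((meas_rho E).comp hu).div_const 2).mul
        ((measurable_one.indicator hN'.compl).comp hu)
  have hxN : x.1 ∈ (Subtype.val '' N : Set (Fin m → ℝ)) := ⟨x, mem_iInter.2 hiter, rfl⟩
  have hfin := irred hm hN' (by rintro _ ⟨z, _, rfl⟩; exact z.2) hAbs hxN
  have h0 : piPre m E Nᶜ = 0 := by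
    rw [← hpre, ← preimage_compl, piPre_null hN'.compl]
    exact hfin
  refine measure_mono_null ?_ h0
  intro z hzA hzN
  have : ustepIter m E 0 z A = 0 := mem_iInter.1 hzN 0
  simp only [ustepIter] at this
  rw [Measure.dirac_apply' _ hA, indicator_of_mem hzA] at this
  simp at this

/-- Abstract uniqueness. -/
lemma uniq {X : Type*} [MeasurableSpace X] {Q : X → Measure X} (hQ : Measurable Q)
    (hQ1 : ∀ x, Q x univ = 1) {μ ν : Measure X} [IsProbabilityMeasure μ] [IsProbabilityMeasure ν]
    (hμ : μ.bind Q = μ) (hν : ν.bind Q = ν)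
    (hpos : ∀ x A, MeasurableSet A → Q x A = 0 → ν A = 0) : μ = ν := by
  -- general one-sided claim
  have key : ∀ (α β : Measure X) [IsProbabilityMeasure α] [IsProbabilityMeasure β],
      α.bind Q = α → β.bind Q = β → ∀ s, MeasurableSet s →
      (∀ t, MeasurableSet t → t ⊆ s → β t ≤ α t) → (∀ t, MeasurableSet t → t ⊆ sᶜ → α t ≤ β t) →
      ν s ≠ 0 → α = β := by
    intro α β _ _ hα hβ s hs h1 h2 h0
    have hm : Measurable (fun x => Q x s) := (Measure.measurable_coe hs).comp hQ
    have hle1 : β.restrict s ≤ α.restrict s := by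
      refine Measure.le_iff.2 fun t ht => ?_
      rw [Measure.restrict_apply ht, Measure.restrict_apply ht]
      exact h1 _ (ht.inter hs) inter_subset_right
    have hle2 : α.restrict sᶜ ≤ β.restrict sᶜ := by
      refine Measure.le_iff.2 fun t ht => ?_
      rw [Measure.restrict_apply ht, Measure.restrict_apply ht]
      exact h2 _ (ht.inter hs.compl) inter_subset_right
    have hQle : ∀ x, Q x s ≤ 1 := fun x => (measure_mono (subset_univ _)).trans (hQ1 x).le
    have dec : ∀ (γ : Measure X), γ.bind Q = γ → γ s = ∫⁻ x in s, Q x s ∂γ + ∫⁻ x in sᶜ, Q x s ∂γ := by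
      intro γ hγ
      rw [lintegral_add_compl _ hs, ← Measure.bind_apply hs hQ.aemeasurable, hγ]
    -- difference measures
    set d1 := α.restrict s - β.restrict s with hd1
    set d2 := β.restrict sᶜ - α.restrict sᶜ with hd2
    have ed1 : α.restrict s = d1 + β.restrict s := (Measure.sub_add_cancel_of_le hle1).symm
    have ed2 : β.restrict sᶜ = d2 + α.restrict sᶜ := (Measure.sub_add_cancel_of_le hle2).symm
    have a1 := dec α hα
    have b1 := dec β hβ
    have s1 : α s = d1 univ + β s := by
      have := congrArg (fun γ : Measure X => γ univ) ed1
      simpa using this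
    have i1 : ∫⁻ x in s, Q x s ∂α = ∫⁻ x, Q x s ∂d1 + ∫⁻ x in s, Q x s ∂β := by
      rw [ed1, lintegral_add_measure]
    have i2 : ∫⁻ x in sᶜ, Q x s ∂β = ∫⁻ x, Q x s ∂d2 + ∫⁻ x in sᶜ, Q x s ∂α := by
      rw [ed2, lintegral_add_measure]
    have i3 : ∫⁻ x, Q x s ∂d1 ≤ d1 univ := by
      calc ∫⁻ x, Q x s ∂d1 ≤ ∫⁻ _, 1 ∂d1 := lintegral_mono hQle
        _ = d1 univ := by simp
    have f1 : ∀ (γ : Measure X) [IsProbabilityMeasure γ] (t : Set X), ∫⁻ x in t, Q x s ∂γ ≠ ⊤ := by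
      intro γ _ t
      refine ne_top_of_le_ne_top (measure_ne_top γ t) ?_
      calc ∫⁻ x in t, Q x s ∂γ ≤ ∫⁻ _ in t, 1 ∂γ := lintegral_mono hQle
        _ = γ t := by simp
    have z : ∫⁻ x, Q x s ∂d2 = 0 := by
      have fβ := f1 β s
      have fα := f1 α sᶜ
      have fβ' := f1 β sᶜ
      have fα' := f1 α s
      have fd : d1 univ ≠ ⊤ := by
        intro h; rw [h] at s1; simp at s1
      have fd1 : ∫⁻ x, Q x s ∂d1 ≠ ⊤ := ne_top_of_le_ne_top fd i3
      have fd2 : ∫⁻ x, Q x s ∂d2 ≠ ⊤ := by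
        intro h; rw [h] at i2; simp [fβ'] at i2
      rw [a1, b1, i1, i2] at s1
      generalize ∫⁻ x, Q x s ∂d2 = p at *
      generalize ∫⁻ x, Q x s ∂d1 = q at *
      generalize ∫⁻ x in s, Q x s ∂β = r at *
      generalize ∫⁻ x in sᶜ, Q x s ∂α = w at *
      generalize d1 univ = y at *
      lift p to NNReal using fd2
      lift q to NNReal using fd1
      lift r to NNReal using fβ
      lift w to NNReal using fα
      lift y to NNReal using fd
      norm_cast at *
      have s1' : (q:ℝ) + r + w = y + (r + (p + w)) := by exact_mod_cast s1
      have i3' : (q:ℝ) ≤ y := by exact_mod_cast i3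
      have hp : (0:ℝ) ≤ p := p.2
      have : (p:ℝ) = 0 := by linarith
      exact_mod_cast this
    rw [lintegral_eq_zero_iff hm] at z
    have d20 : d2 = 0 := by
      rw [← Measure.measure_univ_eq_zero]
      have : ∀ᵐ x ∂d2, False := by
        filter_upwards [z] with x hx
        exact h0 (hpos x s hs hx)
      simpa [ae_iff] using this
    rw [d20, zero_add] at ed2
    have hle : β ≤ α := by
      refine Measure.le_iff.2 fun t ht => ?_
      rw [← measure_inter_add_sdiff t hs, ← measure_inter_add_sdiff (μ := α) t hs]
      gcongr ?_ + ?_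
      · exact h1 _ (ht.inter hs) inter_subset_right
      · have := congrArg (fun γ : Measure X => γ t) ed2
        simp only [Measure.restrict_apply ht] at this
        rw [sdiff_eq, this]
    exact (Measure.eq_of_le_of_measure_univ_eq hle (by simp)).symm
  obtain ⟨s, hs, h1, h2⟩ := hahn_decomposition μ ν
  by_cases h0 : ν s = 0
  · refine (key ν μ hν hμ sᶜ hs.compl h2 ?_ ?_).symm
    · rw [compl_compl]; exact h1
    · rw [prob_compl_eq_one_sub hs, h0]; simp
  · exact key μ ν hμ hν s hs h1 h2 h0

end EEx
end

/-- Theorem 1. The measure `π` is the unique invariant probability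
measure of the energy-exchange process; hence it is ergodic. -/
theorem pi_unique_invariant (m : ℕ) (hm : 1 ≤ m) (E : ℝ) (hE : 0 < E)
    (μ : Measure (Delta m E)) (hμ : IsProbabilityMeasure μ)
    (hinv : ∀ t : ℝ, 0 < t → μ.bind (Pt m E t) = μ) :
    μ = piMeasure m E := by
  have hZ := EEx.Z_fin m E hE
  have hZ0 := EEx.Z_pos m E hE
  have hp : IsProbabilityMeasure (piMeasure m E) := ⟨by
    unfold piMeasure
    rw [Measure.smul_apply, smul_eq_mul, ENNReal.inv_mul_cancel hZ0 hZ]⟩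
  refine EEx.uniq (EEx.meas_Pt m E 1) (EEx.Pt_univ hm hE) (hinv 1 one_pos) ?_ ?_
  · ext A hA
    rw [Measure.bind_apply hA (EEx.meas_Pt m E 1).aemeasurable]
    unfold piMeasure
    rw [lintegral_smul_measure, ← Measure.bind_apply hA (EEx.meas_Pt m E 1).aemeasurable,
      EEx.inv_Pt hm hE]
    rfl
  · intro x A hA h
    unfold piMeasure
    rw [Measure.smul_apply, EEx.Pt_pos hm hE x hA h, smul_zero]
end
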